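/- Let p and q be probability vectors on [N] with H(p) > H(q) and p stochastically dominating q, let ζ be an ergodic monotone joining of p^ℤ and q^ℤ, and let a ∈ [N] with 0 < p_a < 1. Let κ be a positive integer such that the entropy of the first marginal of Γ is strictly greater than the entropy of its second marginal, where Γ is the restriction ζ|_{[1,κ]} (a probability measure on [N]^κ × [N]^κ with marginals p^κ and q^κ) conditioned on the event {(x, y) : x ≠ a^κ}. Then for every η > 0 there exist a positive integer m and a probability measure β̄ on [N]^{mκ} × [N]^{mκ} that is subordinate to the m-fold product Γ^m and has the same marginals as Γ^m, such that for every n ≥ 1 the following holds: let Z̄₀ have law β̄, let Z₁, …, Z_n be i.i.d. with law Γ and independent of Z̄₀, and let W_n = (𝐗_n, 𝐘_n) be the iterative star-coupling of Z̄₀, Z₁, …, Z_n (with all coordinate spaces ordered lexicographically using the natural order on [N]); then there exists a deterministic function Ψ : [N]^{(m+n)κ} → [N]^{(m+n)κ} such that P(𝐘_n = Ψ(𝐗_n)) > 1 − η. -/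

import Mathlib

open MeasureTheory ProbabilityTheory

/-- The left shift on `ℤ → Fin N`. -/
def shiftMap {N : ℕ} (x : ℤ → Fin N) : ℤ → Fin N := fun i => x (i + 1)

/-- `μ` is the Bernoulli (product) measure `p^ℤ` on `(Fin N)^ℤ`. -/
def IsBernoulli {N : ℕ} (p : Fin N → ℝ) (μ : Measure (ℤ → Fin N)) : Prop :=
  IsProbabilityMeasure μ ∧
    ∀ (s : Finset ℤ) (f : ℤ → Fin N),
      μ {x | ∀ i ∈ s, x i = f i} = ∏ i ∈ s, ENNReal.ofReal (p (f i))

/-- Shannon entropy of a probability vector. -/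
noncomputable def shannonH {N : ℕ} (p : Fin N → ℝ) : ℝ :=
  -∑ i, p i * Real.log (p i)

/-- Shannon entropy of a (discrete) measure on a finite type. -/
noncomputable def entropyOf {E : Type*} [Fintype E] [MeasurableSpace E] (μ : Measure E) : ℝ :=
  -∑ e, (μ {e}).toReal * Real.log ((μ {e}).toReal)

/-- The generalized inverse `F⁻¹(u) = sup {t | F t < u}` of a distribution function. -/
noncomputable def qinv (F : ℝ → ℝ) (u : ℝ) : ℝ := sSup {t : ℝ | F t < u}

/-- del Junco's star-coupling, at the level of laws.  Here `l₁` and `l₂` are the laws of two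
pairs `(X₁, Y₁)` and `(X₂, Y₂)` of random variables taking values in finite totally ordered
sets, encoded as finite sets of nonnegative reals with the values of `X₂` and `Y₂` lying in
`[0, K)`.  Using three independent uniform random variables `u = w.1`, `v₁ = w.2.1`,
`v₂ = w.2.2` on `(0,1)`, one sets `Y₁' = F_{Y₁}⁻¹(v₁)`, `X₂' = F_{X₂}⁻¹(v₂)`, and then
`X₁' = s_{Y₁'}⁻¹(u)`, `Y₂' = t_{X₂'}⁻¹(u)`, where `s_{f₁}(e) = P(X₁ ≤ e | Y₁ = f₁)` and
`t_{e₂}(f) = P(Y₂ ≤ f | X₂ = e₂)`.  The result is the law of the pair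
`((X₁', X₂'), (Y₁', Y₂'))`, with the lexicographic pairing encoded by `(x₁, x₂) ↦ x₁ * K + x₂`. -/
noncomputable def starJoin (l₁ l₂ : Measure (ℝ × ℝ)) (K : ℝ) : Measure (ℝ × ℝ) :=
  Measure.map
    (fun w : ℝ × ℝ × ℝ =>
      let f₁ := qinv (fun t => (l₁ {z | z.2 ≤ t}).toReal) w.2.1
      let e₂ := qinv (fun t => (l₂ {z | z.1 ≤ t}).toReal) w.2.2
      let e₁ := qinv
        (fun t => (l₁ {z | z.1 ≤ t ∧ z.2 = f₁}).toReal / (l₁ {z | z.2 = f₁}).toReal) w.1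
      let f₂ := qinv
        (fun t => (l₂ {z | z.2 ≤ t ∧ z.1 = e₂}).toReal / (l₂ {z | z.1 = e₂}).toReal) w.1
      (e₁ * K + e₂, f₁ * K + f₂))
    ((volume.restrict (Set.Ioo (0 : ℝ) 1)).prod
      ((volume.restrict (Set.Ioo (0 : ℝ) 1)).prod (volume.restrict (Set.Ioo (0 : ℝ) 1))))

/-- The iterative star-coupling `W_n`: `W_0 = w₀` and `W_{j+1}` is the star-coupling of `W_j`
with a fresh pair of law `g` (fresh independent uniforms are used at each step, so the law of
the iterative star-coupling depends only on the laws of the inputs). -/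
noncomputable def iterStar (w₀ g : Measure (ℝ × ℝ)) (K : ℝ) : ℕ → Measure (ℝ × ℝ)
  | 0 => w₀
  | n + 1 => starJoin (iterStar w₀ g K n) g K

/-- Order-preserving encoding of a `κ`-block over the alphabet `Fin N`, with the
lexicographic order, as a real number (base-`N` expansion). -/
noncomputable def encodeBlock {N κ : ℕ} (z : Fin κ → Fin N) : ℝ :=
  ∑ i : Fin κ, ((z i : ℕ) : ℝ) * (N : ℝ) ^ (κ - 1 - (i : ℕ))

/-- Order-preserving encoding of an `m`-tuple of `κ`-blocks (the initial block), with the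
lexicographic order, as a real number (base-`N^κ` expansion). -/
noncomputable def encodeInit {N κ m : ℕ} (f : Fin m → Fin κ → Fin N) : ℝ :=
  ∑ i : Fin m, encodeBlock (f i) * ((N : ℝ) ^ κ) ^ (m - 1 - (i : ℕ))

/-- The `m`-fold product `Γ^m` of a coupling `Γ`, as a coupling of the product marginals. -/
noncomputable def prodCoupling {α β : Type*} [MeasurableSpace α] [MeasurableSpace β]
    (m : ℕ) (Γ : Measure (α × β)) : Measure ((Fin m → α) × (Fin m → β)) :=
  (Measure.pi fun _ : Fin m => Γ).map fun f => (fun i => (f i).1, fun i => (f i).2)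

open scoped ENNReal

/-- The uniform law on `(0, 1)`. -/
noncomputable abbrev unifLaw : Measure ℝ := volume.restrict (Set.Ioo (0 : ℝ) 1)

instance : IsProbabilityMeasure unifLaw := ⟨by simp⟩

lemma qinv_le_iff {F : ℝ → ℝ} (hF : Monotone F) (hr : ∀ t, ContinuousWithinAt F (Set.Ici t) t)
    {v : ℝ} (hlo : ∃ t, F t < v) (hhi : ∃ t, v ≤ F t) (t : ℝ) : qinv F v ≤ t ↔ v ≤ F t := by
  obtain ⟨t₀, ht₀⟩ := hhi
  have hbdd : BddAbove {s : ℝ | F s < v} :=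
    ⟨t₀, fun s hs => le_of_not_gt fun h => absurd (hF h.le) (by simp at hs; linarith)⟩
  constructor
  · intro h
    have h1 : ∀ᶠ s in nhdsWithin t (Set.Ioi t), v ≤ F s := by
      filter_upwards [self_mem_nhdsWithin] with s hs
      by_contra! hlt
      exact absurd (le_csSup hbdd hlt) (not_le.2 (lt_of_le_of_lt h hs))
    exact ge_of_tendsto ((hr t).mono_left (nhdsWithin_mono _ Set.Ioi_subset_Ici_self)) h1
  · intro h
    exact csSup_le hlo fun s hs => le_of_not_gt fun hts =>
      absurd (hF hts.le) (by simp at hs; linarith)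

lemma qinv_cdf_le_iff (α : Measure ℝ) {v : ℝ} (hv : 0 < v) (hhi : ∃ t, v ≤ cdf α t) (t : ℝ) :
    qinv (cdf α) v ≤ t ↔ v ≤ cdf α t :=
  qinv_le_iff (monotone_cdf α) (cdf α).right_continuous
    (((tendsto_cdf_atBot α).eventually_lt_const hv).exists) hhi t

lemma exists_le_cdf (α : Measure ℝ) {v : ℝ} (hv : v < 1) : ∃ t, v ≤ cdf α t :=
  (((tendsto_cdf_atTop α).eventually_const_lt hv).exists).imp fun _ => le_of_lt

lemma qinv_cdf_mono (α : Measure ℝ) {u v : ℝ} (hu : 0 < u) (huv : u ≤ v)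
    (hhi : ∃ t, v ≤ cdf α t) : qinv (cdf α) u ≤ qinv (cdf α) v :=
  (qinv_cdf_le_iff α hu (hhi.imp fun _ => huv.trans) _).2
    (huv.trans ((qinv_cdf_le_iff α (hu.trans_le huv) hhi _).1 le_rfl))

lemma aemeasurable_qinv_cdf (α : Measure ℝ) : AEMeasurable (qinv (cdf α)) unifLaw :=
  aemeasurable_restrict_of_monotoneOn measurableSet_Ioo fun _ hu _ hv huv =>
    qinv_cdf_mono α hu.1 huv (exists_le_cdf α hv.2)

lemma map_qinv_cdf (α : Measure ℝ) [IsProbabilityMeasure α] :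
    unifLaw.map (qinv (cdf α)) = α := by
  have := Measure.isProbabilityMeasure_map (aemeasurable_qinv_cdf α)
  refine Measure.ext_of_Iic _ _ fun t => ?_
  rw [Measure.map_apply_of_aemeasurable (aemeasurable_qinv_cdf α) measurableSet_Iic,
    Measure.restrict_apply' measurableSet_Ioo]
  have hle : cdf α t ≤ 1 := cdf_le_one α t
  have h0 : 0 ≤ cdf α t := cdf_nonneg α t
  have key : (qinv (cdf α) ⁻¹' Set.Iic t ∩ Set.Ioo 0 1) = Set.Ioc 0 (cdf α t) ∩ Set.Ioo 0 1 := by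
    ext v
    simp only [Set.mem_inter_iff, Set.mem_preimage, Set.mem_Iic, Set.mem_Ioo, Set.mem_Ioc]
    constructor
    · rintro ⟨h, h1, h2⟩
      exact ⟨⟨h1, (qinv_cdf_le_iff α h1 (exists_le_cdf α h2) t).1 h⟩, h1, h2⟩
    · rintro ⟨⟨_, h⟩, h1, h2⟩
      exact ⟨(qinv_cdf_le_iff α h1 (exists_le_cdf α h2) t).2 h, h1, h2⟩
  have key2 : volume (Set.Ioc 0 (cdf α t) ∩ Set.Ioo 0 1) = volume (Set.Ioc 0 (cdf α t)) := by
    refine le_antisymm (measure_mono Set.inter_subset_left) ?_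
    calc volume (Set.Ioc 0 (cdf α t)) = volume (Set.Ioo 0 (cdf α t)) := by simp
      _ ≤ volume (Set.Ioc 0 (cdf α t) ∩ Set.Ioo 0 1) :=
        measure_mono fun v hv => ⟨⟨hv.1, hv.2.le⟩, hv.1, hv.2.trans_le hle⟩
  rw [key, key2, Real.volume_Ioc, sub_zero, cdf_eq_real, Measure.real,
    ENNReal.ofReal_toReal (measure_ne_top _ _)]

/-- A law on `ℝ` carried by the natural numbers. -/
def NatCarried (α : Measure ℝ) : Prop := ∀ᵐ x ∂α, ∃ k : ℕ, x = (k : ℝ)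

/-- A conditional quantile of the first coordinate of `l` given the second one. -/
noncomputable def condQuantile (l : Measure (ℝ × ℝ)) (f u : ℝ) : ℝ :=
  qinv (fun t => (l {z | z.1 ≤ t ∧ z.2 = f}).toReal / (l {z | z.2 = f}).toReal) u

/-- The conditional law of the first coordinate of `l` given the second one. -/
noncomputable def condFst (l : Measure (ℝ × ℝ)) (f : ℝ) : Measure ℝ :=
  (l[|{z | z.2 = f}]).map Prod.fst

lemma measurableSet_snd_eq (f : ℝ) : MeasurableSet {z : ℝ × ℝ | z.2 = f} :=
  measurable_snd (measurableSet_singleton f)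

lemma isProbabilityMeasure_condFst (l : Measure (ℝ × ℝ)) [IsFiniteMeasure l] {f : ℝ}
    (hf : l {z | z.2 = f} ≠ 0) : IsProbabilityMeasure (condFst l f) :=
  have := cond_isProbabilityMeasure hf
  Measure.isProbabilityMeasure_map measurable_fst.aemeasurable

lemma condFst_apply_mul (l : Measure (ℝ × ℝ)) [IsFiniteMeasure l] {f : ℝ}
    (hf : l {z | z.2 = f} ≠ 0) {B : Set ℝ} (hB : MeasurableSet B) :
    condFst l f B * l {z | z.2 = f} = l {z | z.1 ∈ B ∧ z.2 = f} := by
  rw [condFst, Measure.map_apply measurable_fst hB, cond_apply (measurableSet_snd_eq f), mul_comm,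
    ← mul_assoc, ENNReal.mul_inv_cancel hf (measure_ne_top _ _), one_mul]
  congr 1
  ext z
  simp [and_comm]

lemma condQuantile_eq (l : Measure (ℝ × ℝ)) [IsFiniteMeasure l] {f : ℝ}
    (hf : l {z | z.2 = f} ≠ 0) : condQuantile l f = qinv (cdf (condFst l f)) := by
  have := isProbabilityMeasure_condFst l hf
  funext u
  unfold condQuantile
  congr 1
  funext t
  have h := condFst_apply_mul l hf (measurableSet_Iic (a := t))
  simp only [Set.mem_Iic] at h
  rw [cdf_eq_real, ← h, ENNReal.toReal_mul, mul_div_assoc, div_self, mul_one, Measure.real]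
  exact ENNReal.toReal_ne_zero.2 ⟨hf, measure_ne_top _ _⟩

lemma aemeasurable_condQuantile (l : Measure (ℝ × ℝ)) [IsFiniteMeasure l] (f : ℝ) :
    AEMeasurable (condQuantile l f) unifLaw := by
  by_cases hf : l {z | z.2 = f} = 0
  · have : ∀ᵐ u ∂unifLaw, condQuantile l f u = 0 := by
      filter_upwards [ae_restrict_mem measurableSet_Ioo] with u hu
      simp [condQuantile, qinv, hf, hu.1]
    exact ⟨fun _ => 0, measurable_const, this⟩
  · rw [condQuantile_eq l hf]
    exact aemeasurable_qinv_cdf _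

/-- The quantile function of the second coordinate of `l`. -/
noncomputable def sndQuantile (l : Measure (ℝ × ℝ)) (v : ℝ) : ℝ :=
  qinv (fun t => (l {z | z.2 ≤ t}).toReal) v

lemma sndQuantile_eq (l : Measure (ℝ × ℝ)) [IsProbabilityMeasure l] :
    sndQuantile l = qinv (cdf (l.map Prod.snd)) := by
  have := Measure.isProbabilityMeasure_map (μ := l) measurable_snd.aemeasurable
  funext v
  unfold sndQuantile
  congr 1
  funext t
  rw [cdf_eq_real, Measure.real, Measure.map_apply measurable_snd measurableSet_Iic]
  rfl

lemma aemeasurable_sndQuantile (l : Measure (ℝ × ℝ)) [IsProbabilityMeasure l] :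
    AEMeasurable (sndQuantile l) unifLaw := by
  rw [sndQuantile_eq]
  exact aemeasurable_qinv_cdf _

lemma map_sndQuantile (l : Measure (ℝ × ℝ)) [IsProbabilityMeasure l] :
    unifLaw.map (sndQuantile l) = l.map Prod.snd := by
  have := Measure.isProbabilityMeasure_map (μ := l) measurable_snd.aemeasurable
  rw [sndQuantile_eq, map_qinv_cdf]

/-- Sampling the second coordinate of `l` and then the first one conditionally on it. -/
noncomputable def resample (l : Measure (ℝ × ℝ)) (w : ℝ × ℝ) : ℝ × ℝ :=
  (condQuantile l (sndQuantile l w.2) w.1, sndQuantile l w.2)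

lemma ae_sndQuantile_nat (l : Measure (ℝ × ℝ)) [IsProbabilityMeasure l]
    (hl : NatCarried (l.map Prod.snd)) : ∀ᵐ v ∂unifLaw, ∃ k : ℕ, sndQuantile l v = k := by
  rw [NatCarried, ← map_sndQuantile] at hl
  exact ae_of_ae_map (aemeasurable_sndQuantile l) hl

lemma aemeasurable_resample (l : Measure (ℝ × ℝ)) [IsProbabilityMeasure l]
    (hl : NatCarried (l.map Prod.snd)) :
    AEMeasurable (resample l) (unifLaw.prod unifLaw) := by
  have hQ : AEMeasurable (fun w : ℝ × ℝ => sndQuantile l w.2) (unifLaw.prod unifLaw) :=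
    (aemeasurable_sndQuantile l).comp_quasiMeasurePreserving Measure.quasiMeasurePreserving_snd
  refine AEMeasurable.prodMk ?_ hQ
  let G : ℕ × ℝ → ℝ := fun z => (aemeasurable_condQuantile l (z.1 : ℝ)).mk _ z.2
  have hG : Measurable G := measurable_from_prod_countable_right fun k =>
    (aemeasurable_condQuantile l (k : ℝ)).measurable_mk
  have hcomp : AEMeasurable (fun w : ℝ × ℝ => G (⌊sndQuantile l w.2⌋₊, w.1))
      (unifLaw.prod unifLaw) :=
    hG.comp_aemeasurable
      ((Nat.measurable_floor.comp_aemeasurable hQ).prodMk measurable_fst.aemeasurable)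
  refine hcomp.congr ?_
  have h1 := Measure.quasiMeasurePreserving_snd (μ := unifLaw) (ν := unifLaw) |>.ae
    (ae_sndQuantile_nat l hl)
  have h2 := Measure.quasiMeasurePreserving_fst (μ := unifLaw) (ν := unifLaw) |>.ae
    (ae_all_iff.2 fun k : ℕ => (aemeasurable_condQuantile l (k : ℝ)).ae_eq_mk)
  filter_upwards [h1, h2] with w ⟨k, hk⟩ hw
  simp only [hk, Nat.floor_natCast]
  exact (hw k).symm

lemma map_resample (l : Measure (ℝ × ℝ)) [IsProbabilityMeasure l]
    (hl : NatCarried (l.map Prod.snd)) : (unifLaw.prod unifLaw).map (resample l) = l := by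
  have hm := aemeasurable_resample l hl
  have := Measure.isProbabilityMeasure_map hm
  refine Measure.eq_of_le_of_measure_univ_eq (Measure.le_iff.2 fun s hs => ?_) (by simp)
  rw [Measure.map_apply_of_aemeasurable hm hs]
  have hbad : unifLaw {v | ¬ ∃ k : ℕ, sndQuantile l v = k} = 0 := ae_sndQuantile_nat l hl
  have hsub : resample l ⁻¹' s ⊆ (Set.univ ×ˢ {v | ¬ ∃ k : ℕ, sndQuantile l v = k}) ∪
      ⋃ k : ℕ, {u | (condQuantile l k u, (k : ℝ)) ∈ s} ×ˢ {v | sndQuantile l v = k} := by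
    rintro ⟨u, v⟩ h
    by_cases hk : ∃ k : ℕ, sndQuantile l v = k
    · obtain ⟨k, hk⟩ := hk
      refine Or.inr (Set.mem_iUnion.2 ⟨k, ?_, hk⟩)
      simpa [resample, hk] using h
    · exact Or.inl ⟨trivial, hk⟩
  have hrect : ∀ k : ℕ, (unifLaw.prod unifLaw)
      ({u | (condQuantile l k u, (k : ℝ)) ∈ s} ×ˢ {v | sndQuantile l v = k}) =
      l (s ∩ {z | z.2 = k}) := by
    intro k
    have hv : unifLaw {v | sndQuantile l v = k} = l {z | z.2 = k} := by
      have := congrArg (fun μ : Measure ℝ => μ {(k : ℝ)}) (map_sndQuantile l)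
      rwa [Measure.map_apply_of_aemeasurable (aemeasurable_sndQuantile l)
        (measurableSet_singleton _), Measure.map_apply measurable_snd
        (measurableSet_singleton _)] at this
    rw [Measure.prod_prod, hv]
    by_cases hf : l {z | z.2 = (k : ℝ)} = 0
    · rw [hf, mul_zero]
      exact (measure_mono_null Set.inter_subset_right hf).symm
    have := isProbabilityMeasure_condFst l hf
    have hs' : MeasurableSet {x : ℝ | (x, (k : ℝ)) ∈ s} := measurable_prodMk_right hs
    have hu : unifLaw {u | (condQuantile l k u, (k : ℝ)) ∈ s} =
        condFst l k {x | (x, (k : ℝ)) ∈ s} := by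
      conv_rhs => rw [← map_qinv_cdf (condFst l k), ← condQuantile_eq l hf]
      rw [Measure.map_apply_of_aemeasurable (aemeasurable_condQuantile l k) hs']
      rfl
    rw [hu, condFst_apply_mul l hf hs']
    congr 1
    ext ⟨x, y⟩
    simp only [Set.mem_ofPred_eq, Set.mem_inter_iff]
    constructor
    · rintro ⟨h, rfl⟩; exact ⟨h, rfl⟩
    · rintro ⟨h, rfl⟩; exact ⟨h, rfl⟩
  calc (unifLaw.prod unifLaw) (resample l ⁻¹' s) ≤ _ := measure_mono hsub
    _ ≤ 0 + ∑' k : ℕ, l (s ∩ {z | z.2 = k}) := by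
      refine (measure_union_le _ _).trans (add_le_add ?_ ?_)
      · rw [Measure.prod_prod, hbad, mul_zero]
      · exact (measure_iUnion_le _).trans (ENNReal.tsum_le_tsum fun k => (hrect k).le)
    _ = l (⋃ k : ℕ, s ∩ {z | z.2 = k}) := by
      rw [zero_add, measure_iUnion]
      · intro i j hij
        refine Set.disjoint_left.2 ?_
        rintro z ⟨_, h1⟩ ⟨_, h2⟩
        exact hij (by simpa using (h1 : z.2 = i).symm.trans h2)
      · exact fun k => hs.inter (measurableSet_snd_eq _)
    _ ≤ l s := measure_mono (Set.iUnion_subset fun _ => Set.inter_subset_left)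

/-- The law of three independent uniform variables. -/
noncomputable abbrev unifLaw₃ : Measure (ℝ × ℝ × ℝ) := unifLaw.prod (unifLaw.prod unifLaw)

lemma MeasureTheory.Measure.map_prodMap_of_aemeasurable {α β γ δ : Type*} [MeasurableSpace α]
    [MeasurableSpace β] [MeasurableSpace γ] [MeasurableSpace δ] {μ : Measure α} {ν : Measure β}
    [SFinite μ] [SFinite ν] {f : α → γ} {g : β → δ}
    (hf : AEMeasurable f μ) (hg : AEMeasurable g ν) :
    AEMeasurable (Prod.map f g) (μ.prod ν) ∧
      (μ.prod ν).map (Prod.map f g) = (μ.map f).prod (ν.map g) := by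
  have hae : Prod.map f g =ᵐ[μ.prod ν] Prod.map (hf.mk f) (hg.mk g) := by
    filter_upwards [Measure.quasiMeasurePreserving_fst.ae hf.ae_eq_mk,
      Measure.quasiMeasurePreserving_snd.ae hg.ae_eq_mk] with w h1 h2
    simp [Prod.map, h1, h2]
  refine ⟨⟨_, hf.measurable_mk.prodMap hg.measurable_mk, hae⟩, ?_⟩
  rw [Measure.map_congr hae, Measure.map_congr hf.ae_eq_mk, Measure.map_congr hg.ae_eq_mk,
    Measure.map_prod_map _ _ hf.measurable_mk hg.measurable_mk]

lemma map_resample_sndQuantile (l l' : Measure (ℝ × ℝ)) [IsProbabilityMeasure l]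
    [IsProbabilityMeasure l'] (hl : NatCarried (l.map Prod.snd)) :
    AEMeasurable (fun w : ℝ × ℝ × ℝ => (resample l (w.1, w.2.1), sndQuantile l' w.2.2))
        unifLaw₃ ∧
      unifLaw₃.map (fun w => (resample l (w.1, w.2.1), sndQuantile l' w.2.2)) =
        l.prod (l'.map Prod.snd) := by
  obtain ⟨h1, h2⟩ := Measure.map_prodMap_of_aemeasurable (aemeasurable_resample l hl)
    (aemeasurable_sndQuantile l')
  have hT := (measurePreserving_prodAssoc unifLaw unifLaw unifLaw).symm
  have hmap := AEMeasurable.map_map_of_aemeasurable (by rwa [hT.map_eq]) hT.measurable.aemeasurable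
    (g := Prod.map (resample l) (sndQuantile l'))
  rw [hT.map_eq, h2, map_resample l hl, map_sndQuantile] at hmap
  have hcomp : (fun w : ℝ × ℝ × ℝ => (resample l (w.1, w.2.1), sndQuantile l' w.2.2)) =
      Prod.map (resample l) (sndQuantile l') ∘ MeasurableEquiv.prodAssoc.symm := rfl
  rw [hcomp]
  exact ⟨h1.comp_quasiMeasurePreserving hT.quasiMeasurePreserving, hmap.symm⟩

lemma map_resample_sndQuantile' (l l' : Measure (ℝ × ℝ)) [IsProbabilityMeasure l]
    [IsProbabilityMeasure l'] (hl' : NatCarried (l'.map Prod.snd)) :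
    AEMeasurable (fun w : ℝ × ℝ × ℝ => (resample l' (w.1, w.2.2), sndQuantile l w.2.1))
        unifLaw₃ ∧
      unifLaw₃.map (fun w => (resample l' (w.1, w.2.2), sndQuantile l w.2.1)) =
        l'.prod (l.map Prod.snd) := by
  obtain ⟨h1, h2⟩ := map_resample_sndQuantile l' l hl'
  have hT : MeasurePreserving (Prod.map (id : ℝ → ℝ) (Prod.swap : ℝ × ℝ → ℝ × ℝ))
      unifLaw₃ unifLaw₃ :=
    (MeasurePreserving.id unifLaw).prod Measure.measurePreserving_swap
  have hcomp : (fun w : ℝ × ℝ × ℝ => (resample l' (w.1, w.2.2), sndQuantile l w.2.1)) =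
      (fun w : ℝ × ℝ × ℝ => (resample l' (w.1, w.2.1), sndQuantile l w.2.2)) ∘
        Prod.map (id : ℝ → ℝ) (Prod.swap : ℝ × ℝ → ℝ × ℝ) := rfl
  rw [hcomp]
  refine ⟨h1.comp_quasiMeasurePreserving hT.quasiMeasurePreserving, ?_⟩
  have hmap := AEMeasurable.map_map_of_aemeasurable (by rwa [hT.map_eq]) hT.measurable.aemeasurable
    (g := fun w : ℝ × ℝ × ℝ => (resample l' (w.1, w.2.1), sndQuantile l w.2.2))
  rw [hT.map_eq, h2] at hmap
  exact hmap.symm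

/-- The star-coupling in terms of resampling; `l'` is the law of `(Y₂, X₂)`. -/
noncomputable def starMap (l l' : Measure (ℝ × ℝ)) (K : ℝ) (w : ℝ × ℝ × ℝ) : ℝ × ℝ :=
  ((resample l (w.1, w.2.1)).1 * K + (resample l' (w.1, w.2.2)).2,
    (resample l (w.1, w.2.1)).2 * K + (resample l' (w.1, w.2.2)).1)

lemma starJoin_eq_map (l g : Measure (ℝ × ℝ)) (K : ℝ) :
    starJoin l g K = unifLaw₃.map (starMap l (g.map Prod.swap) K) := by
  have hsw : ∀ s : Set (ℝ × ℝ), (g.map Prod.swap) s = g (Prod.swap ⁻¹' s) := fun s =>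
    MeasurableEquiv.map_apply MeasurableEquiv.prodComm s
  have : starMap l (g.map Prod.swap) K = fun w : ℝ × ℝ × ℝ =>
      let f₁ := qinv (fun t => (l {z | z.2 ≤ t}).toReal) w.2.1
      let e₂ := qinv (fun t => (g {z | z.1 ≤ t}).toReal) w.2.2
      let e₁ := qinv
        (fun t => (l {z | z.1 ≤ t ∧ z.2 = f₁}).toReal / (l {z | z.2 = f₁}).toReal) w.1
      let f₂ := qinv
        (fun t => (g {z | z.2 ≤ t ∧ z.1 = e₂}).toReal / (g {z | z.1 = e₂}).toReal) w.1
      (e₁ * K + e₂, f₁ * K + f₂) := by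
    funext w
    simp only [starMap, resample, condQuantile, sndQuantile, hsw, Set.preimage_ofPred_eq,
      Prod.fst_swap, Prod.snd_swap]
  rw [starJoin, this]

/-- Number pairing in base `K`. -/
noncomputable def pairBase (K : ℝ) (x : ℝ × ℝ) : ℝ := x.1 * K + x.2

lemma measurable_pairBase (K : ℝ) : Measurable (pairBase K) := by
  unfold pairBase; fun_prop

lemma map_snd_map_swap (g : Measure (ℝ × ℝ)) :
    (g.map Prod.swap).map Prod.snd = g.map Prod.fst := by
  rw [Measure.map_map measurable_snd measurable_swap]; rfl

lemma map_fst_map_swap (g : Measure (ℝ × ℝ)) :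
    (g.map Prod.swap).map Prod.fst = g.map Prod.snd := by
  rw [Measure.map_map measurable_fst measurable_swap]; rfl

instance (g : Measure (ℝ × ℝ)) [IsProbabilityMeasure g] : IsProbabilityMeasure (g.map Prod.swap) :=
  Measure.isProbabilityMeasure_map measurable_swap.aemeasurable

lemma aemeasurable_starMap (l g : Measure (ℝ × ℝ)) [IsProbabilityMeasure l]
    [IsProbabilityMeasure g] (K : ℝ) (hl : NatCarried (l.map Prod.snd))
    (hg : NatCarried (g.map Prod.fst)) :
    AEMeasurable (starMap l (g.map Prod.swap) K) unifLaw₃ := by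
  have h1 := (map_resample_sndQuantile l (g.map Prod.swap) hl).1.fst
  have h2 := (map_resample_sndQuantile' l (g.map Prod.swap)
    (by rwa [map_snd_map_swap])).1.fst
  exact ((h1.fst.mul_const K).add h2.snd).prodMk ((h1.snd.mul_const K).add h2.fst)

lemma isProbabilityMeasure_starJoin (l g : Measure (ℝ × ℝ)) [IsProbabilityMeasure l]
    [IsProbabilityMeasure g] (K : ℝ) (hl : NatCarried (l.map Prod.snd))
    (hg : NatCarried (g.map Prod.fst)) :
    IsProbabilityMeasure (starJoin l g K) := by
  rw [starJoin_eq_map]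
  exact Measure.isProbabilityMeasure_map (aemeasurable_starMap l g K hl hg)

lemma map_fst_starJoin (l g : Measure (ℝ × ℝ)) [IsProbabilityMeasure l]
    [IsProbabilityMeasure g] (K : ℝ) (hl : NatCarried (l.map Prod.snd))
    (hg : NatCarried (g.map Prod.fst)) :
    (starJoin l g K).map Prod.fst =
      ((l.map Prod.fst).prod (g.map Prod.fst)).map (pairBase K) := by
  obtain ⟨h1, h2⟩ := map_resample_sndQuantile l (g.map Prod.swap) hl
  rw [map_snd_map_swap] at h2
  rw [starJoin_eq_map, AEMeasurable.map_map_of_aemeasurable measurable_fst.aemeasurable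
    (aemeasurable_starMap l g K hl hg)]
  have e1 : (l.map Prod.fst).prod (g.map Prod.fst) =
      (l.prod (g.map Prod.fst)).map (Prod.map Prod.fst id) := by
    rw [← Measure.map_prod_map _ _ measurable_fst measurable_id, Measure.map_id]
  rw [e1, ← h2, Measure.map_map (measurable_pairBase K) (measurable_fst.prodMap measurable_id),
    AEMeasurable.map_map_of_aemeasurable
      ((measurable_pairBase K).comp (measurable_fst.prodMap measurable_id)).aemeasurable h1]
  rfl

lemma map_snd_starJoin (l g : Measure (ℝ × ℝ)) [IsProbabilityMeasure l]
    [IsProbabilityMeasure g] (K : ℝ) (hl : NatCarried (l.map Prod.snd))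
    (hg : NatCarried (g.map Prod.fst)) :
    (starJoin l g K).map Prod.snd =
      ((l.map Prod.snd).prod (g.map Prod.snd)).map (pairBase K) := by
  obtain ⟨h1, h2⟩ := map_resample_sndQuantile' l (g.map Prod.swap) (by rwa [map_snd_map_swap])
  rw [starJoin_eq_map, AEMeasurable.map_map_of_aemeasurable measurable_snd.aemeasurable
    (aemeasurable_starMap l g K hl hg)]
  have e1 : (l.map Prod.snd).prod (g.map Prod.snd) =
      ((g.map Prod.swap).prod (l.map Prod.snd)).map (Prod.swap ∘ Prod.map Prod.fst id) := by
    rw [← Measure.map_map measurable_swap (measurable_fst.prodMap measurable_id),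
      ← Measure.map_prod_map _ _ measurable_fst measurable_id, Measure.map_id,
      map_fst_map_swap, Measure.prod_swap]
  have hm : Measurable (Prod.swap ∘ Prod.map Prod.fst id : (ℝ × ℝ) × ℝ → ℝ × ℝ) :=
    measurable_swap.comp (measurable_fst.prodMap measurable_id)
  rw [e1, ← h2, Measure.map_map (measurable_pairBase K) hm,
    AEMeasurable.map_map_of_aemeasurable ((measurable_pairBase K).comp hm).aemeasurable h1]
  rfl

lemma NatCarried.ae_measure_singleton_ne_zero {α : Measure ℝ} (hα : NatCarried α) :
    ∀ᵐ x ∂α, α {x} ≠ 0 := by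
  have h : ∀ᵐ x : ℝ ∂α, ∀ k : ℕ, x = (k : ℝ) → α {x} ≠ 0 := by
    rw [ae_all_iff]
    intro k
    by_cases hk : α {(k : ℝ)} = 0
    · filter_upwards [measure_eq_zero_iff_ae_notMem.1 hk] with x hx hxk
      exact absurd hxk hx
    · exact Filter.Eventually.of_forall fun x hx => hx ▸ hk
  filter_upwards [hα, h] with x ⟨k, hk⟩ hx using hx k hk

lemma nullMeasurableSet_of_ae_nat {μ : Measure (ℝ × ℝ)}
    (h₁ : NatCarried (μ.map Prod.fst)) (h₂ : NatCarried (μ.map Prod.snd)) (s : Set (ℝ × ℝ)) :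
    NullMeasurableSet s μ := by
  let R : Set (ℝ × ℝ) := Set.range fun k : ℕ × ℕ => ((k.1 : ℝ), (k.2 : ℝ))
  have hR : ∀ᵐ z ∂μ, z ∈ R := by
    filter_upwards [ae_of_ae_map measurable_fst.aemeasurable h₁,
      ae_of_ae_map measurable_snd.aemeasurable h₂] with z ⟨i, hi⟩ ⟨j, hj⟩
    exact ⟨(i, j), Prod.ext hi.symm hj.symm⟩
  have hs : (s ∩ R : Set (ℝ × ℝ)) =ᵐ[μ] s := by
    filter_upwards [hR] with z hz
    exact propext ⟨fun h => h.1, fun h => ⟨h, hz⟩⟩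
  exact NullMeasurableSet.congr
    (((Set.countable_range _).mono Set.inter_subset_right).measurableSet.nullMeasurableSet) hs

lemma NatCarried.map_pairBase {α α' : Measure ℝ} [SFinite α] [SFinite α'] (hα : NatCarried α)
    (hα' : NatCarried α') (K : ℕ) : NatCarried ((α.prod α').map (pairBase K)) := by
  have hms : MeasurableSet {x : ℝ | ∃ k : ℕ, x = (k : ℝ)} := by
    have : {x : ℝ | ∃ k : ℕ, x = (k : ℝ)} = Set.range fun k : ℕ => (k : ℝ) := by
      ext x; simp [eq_comm]
    rw [this]
    exact (Set.countable_range _).measurableSet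
  rw [NatCarried, ae_map_iff (measurable_pairBase _).aemeasurable hms]
  filter_upwards [Measure.quasiMeasurePreserving_fst.ae hα,
    Measure.quasiMeasurePreserving_snd.ae hα'] with z ⟨i, hi⟩ ⟨j, hj⟩
  exact ⟨i * K + j, by simp [pairBase, hi, hj]⟩

/-- If `x = qinv (cdf S) u` and `y = qinv (cdf T) u` but `y` is not the value predicted from the
right end of the interval of parameters giving `x`, then that interval contains the jump point
`cdf T y`. -/
lemma eq_qinv_of_ne_predicted (S T : Measure ℝ) {u : ℝ} (hu : u ∈ Set.Ioo (0 : ℝ) 1)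
    (hT : ∃ t, 1 ≤ cdf T t)
    (hne : qinv (cdf T) u ≠ qinv (cdf T) (cdf S (qinv (cdf S) u))) :
    qinv (cdf S) u = qinv (cdf S) (cdf T (qinv (cdf T) u)) := by
  set v := cdf S (qinv (cdf S) u)
  have hSu := exists_le_cdf S hu.2
  have huv : u ≤ v := (qinv_cdf_le_iff S hu.1 hSu _).1 le_rfl
  have hv : ∃ t, v ≤ cdf T t := hT.imp fun _ => (cdf_le_one S _).trans
  have hlt := lt_of_le_of_ne (qinv_cdf_mono T hu.1 huv hv) hne
  have hTv : cdf T (qinv (cdf T) u) < v := by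
    by_contra! h
    exact absurd ((qinv_cdf_le_iff T (hu.1.trans_le huv) hv _).2 h) hlt.not_ge
  have hub : u ≤ cdf T (qinv (cdf T) u) :=
    (qinv_cdf_le_iff T hu.1 (exists_le_cdf T hu.2) _).1 le_rfl
  have hSb := exists_le_cdf S (hTv.trans_le (cdf_le_one S _))
  exact le_antisymm (qinv_cdf_mono S hu.1 hub hSb)
    ((qinv_cdf_le_iff S (hu.1.trans_le hub) hSb _).2 hTv.le)

/-- A law on `ℝ` carried by the natural numbers smaller than `K`. -/
def NatCarriedBelow (α : Measure ℝ) (K : ℕ) : Prop := ∀ᵐ x ∂α, ∃ k < K, x = (k : ℝ)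

lemma NatCarriedBelow.natCarried {α : Measure ℝ} {K : ℕ} (h : NatCarriedBelow α K) :
    NatCarried α := h.mono fun _ ⟨k, _, hk⟩ => ⟨k, hk⟩

lemma one_le_cdf_condFst (l : Measure (ℝ × ℝ)) [IsFiniteMeasure l] {K : ℕ}
    (hl : NatCarriedBelow (l.map Prod.fst) K) {f : ℝ} (hf : l {z | z.2 = f} ≠ 0) :
    1 ≤ cdf (condFst l f) K := by
  have := isProbabilityMeasure_condFst l hf
  have h0 : condFst l f (Set.Iic (K : ℝ))ᶜ = 0 := by
    have h := condFst_apply_mul l hf (measurableSet_Iic (a := (K : ℝ))).compl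
    have h' : l {z | z.1 ∈ (Set.Iic (K : ℝ))ᶜ ∧ z.2 = f} = 0 := by
      refine measure_mono_null (fun z hz => ?_)
        (ae_iff.1 (ae_of_ae_map measurable_fst.aemeasurable hl))
      rintro ⟨k, hk, hzk⟩
      refine hz.1 ?_
      rw [hzk]
      exact (Nat.cast_le (α := ℝ)).2 hk.le
    rw [h', mul_eq_zero] at h
    exact h.resolve_right hf
  rw [cdf_eq_real, (prob_compl_eq_zero_iff measurableSet_Iic |>.1 h0 |> fun h => by
    rw [Measure.real, h]; simp : (condFst l f).real (Set.Iic (K : ℝ)) = 1)]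

lemma exists_predictor_starJoin (l g : Measure (ℝ × ℝ)) [IsProbabilityMeasure l]
    [IsProbabilityMeasure g] {K : ℕ} (hl₁ : NatCarried (l.map Prod.fst))
    (hl₂ : NatCarried (l.map Prod.snd)) (hg₁ : NatCarriedBelow (g.map Prod.fst) K)
    (hg₂ : NatCarriedBelow (g.map Prod.snd) K) {Ψ : ℝ → ℝ} {δ ε : ℝ≥0∞}
    (hΨ : l {z | z.2 ≠ Ψ z.1} ≤ δ) (hε : ∀ h : ℝ → ℝ, l {z | z.1 = h z.2} ≤ ε) :
    ∃ Ψ' : ℝ → ℝ, starJoin l g K {z | z.2 ≠ Ψ' z.1} ≤ δ + K * ε := by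
  set g' := g.map Prod.swap with hg'
  have hg's : g'.map Prod.snd = g.map Prod.fst := map_snd_map_swap g
  have hg'f : g'.map Prod.fst = g.map Prod.snd := map_fst_map_swap g
  have : IsProbabilityMeasure (g.map Prod.fst) :=
    Measure.isProbabilityMeasure_map measurable_fst.aemeasurable
  have : IsProbabilityMeasure (g.map Prod.snd) :=
    Measure.isProbabilityMeasure_map measurable_snd.aemeasurable
  have : IsProbabilityMeasure (l.map Prod.fst) :=
    Measure.isProbabilityMeasure_map measurable_fst.aemeasurable
  have : IsProbabilityMeasure (l.map Prod.snd) :=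
    Measure.isProbabilityMeasure_map measurable_snd.aemeasurable
  obtain ⟨hm1, hmap1⟩ := map_resample_sndQuantile l g' hl₂
  obtain ⟨hm2, hmap2⟩ := map_resample_sndQuantile' l g' (by rw [hg's]; exact hg₁.natCarried)
  rw [hg's] at hmap1
  let jump : ℕ → ℕ → ℝ → ℝ := fun c y f =>
    qinv (cdf (condFst l f)) (cdf (condFst g' c) y)
  let Ψ' : ℝ → ℝ := fun x =>
    Ψ ((⌊x⌋₊ / K : ℕ) : ℝ) * K + qinv (cdf (condFst g' ((⌊x⌋₊ % K : ℕ) : ℝ)))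
      (cdf (condFst l (Ψ ((⌊x⌋₊ / K : ℕ) : ℝ))) ((⌊x⌋₊ / K : ℕ) : ℝ))
  refine ⟨Ψ', ?_⟩
  have hnull : NullMeasurableSet {z : ℝ × ℝ | z.2 ≠ Ψ' z.1} (starJoin l g K) := by
    refine nullMeasurableSet_of_ae_nat ?_ ?_ _
    · rw [map_fst_starJoin l g K hl₂ hg₁.natCarried]
      exact hl₁.map_pairBase hg₁.natCarried K
    · rw [map_snd_starJoin l g K hl₂ hg₁.natCarried]
      exact hl₂.map_pairBase hg₂.natCarried K
  have hstar := aemeasurable_starMap l g K hl₂ hg₁.natCarried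
  rw [starJoin_eq_map] at hnull ⊢
  rw [Measure.map_apply₀ hstar hnull]
  -- the exceptional set, in terms of `((X₁, Y₁), X₂)`
  let bad : Set ((ℝ × ℝ) × ℝ) := ({z | z.2 ≠ Ψ z.1} ×ˢ Set.univ) ∪
    ⋃ c ∈ Finset.range K, ⋃ y ∈ Finset.range K, {z | z.1 = jump c y z.2} ×ˢ {(c : ℝ)}
  have hbad : (l.prod (g.map Prod.fst)) bad ≤ δ + K * ε := by
    refine (measure_union_le _ _).trans (add_le_add ?_ ?_)
    · rw [Measure.prod_prod, measure_univ, mul_one]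
      exact hΨ
    · calc _ ≤ ∑ c ∈ Finset.range K, ∑ y ∈ Finset.range K,
            (l.prod (g.map Prod.fst)) ({z | z.1 = jump c y z.2} ×ˢ {(c : ℝ)}) :=
            (measure_biUnion_finset_le _ _).trans
              (Finset.sum_le_sum fun c _ => measure_biUnion_finset_le _ _)
        _ ≤ ∑ c ∈ Finset.range K, ∑ _y ∈ Finset.range K, ε * (g.map Prod.fst) {(c : ℝ)} := by
            refine Finset.sum_le_sum fun c _ => Finset.sum_le_sum fun y _ => ?_
            rw [Measure.prod_prod]
            gcongr
            exact hε _
        _ = K * ε * ∑ c ∈ Finset.range K, (g.map Prod.fst) {(c : ℝ)} := by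
            simp [Finset.mul_sum, mul_assoc]
        _ ≤ K * ε * 1 := by
            gcongr
            have := sum_measure_singleton (μ := g.map Prod.fst)
              (s := (Finset.range K).map (Nat.castEmbedding (R := ℝ)))
            rw [Finset.sum_map] at this
            simp only [Nat.castEmbedding_apply] at this
            rw [this]
            exact prob_le_one
        _ = K * ε := mul_one _
  have hae1 : ∀ᵐ z ∂(l.prod (g.map Prod.fst)), ((∃ k : ℕ, z.1.1 = (k : ℝ)) ∧
      l {y | y.2 = z.1.2} ≠ 0) ∧ (∃ k < K, z.2 = (k : ℝ)) ∧ g' {y | y.2 = z.2} ≠ 0 := by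
    have hz : ∀ (μ : Measure (ℝ × ℝ)) (x : ℝ), (μ.map Prod.snd) {x} = μ {y | y.2 = x} :=
      fun μ x => Measure.map_apply measurable_snd (measurableSet_singleton x)
    have a1 := ae_of_ae_map measurable_fst.aemeasurable hl₁
    have a2 := ae_of_ae_map measurable_snd.aemeasurable hl₂.ae_measure_singleton_ne_zero
    have a3 := hg₁.natCarried.ae_measure_singleton_ne_zero
    filter_upwards [Measure.quasiMeasurePreserving_fst.ae (a1.and a2),
      Measure.quasiMeasurePreserving_snd.ae (hg₁.and a3)] with z h1 h2
    refine ⟨⟨h1.1, ?_⟩, h2.1, ?_⟩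
    · rw [← hz]; exact h1.2
    · rw [← hz, hg's]; exact h2.2
  have hae2 : ∀ᵐ z ∂(g'.prod (l.map Prod.snd)), ∃ k < K, z.1.1 = (k : ℝ) :=
    Measure.quasiMeasurePreserving_fst.ae
      (ae_of_ae_map measurable_fst.aemeasurable (by rw [hg'f]; exact hg₂))
  rw [← hmap1] at hae1 hbad
  rw [← hmap2] at hae2
  have hu : ∀ᵐ w ∂unifLaw₃, w.1 ∈ Set.Ioo (0 : ℝ) 1 :=
    Measure.quasiMeasurePreserving_fst.ae (ae_restrict_mem measurableSet_Ioo)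
  refine le_trans ?_ ((Measure.le_map_apply hm1 bad).trans hbad)
  refine measure_mono_ae ?_
  filter_upwards [ae_of_ae_map hm1 hae1, ae_of_ae_map hm2 hae2, hu] with w h1 h2 hw hne
  obtain ⟨⟨⟨i, hi⟩, hf₁⟩, ⟨c, hcK, hc⟩, he₂⟩ := h1
  obtain ⟨y, hyK, hy⟩ := h2
  have hK : 0 < K := by omega
  by_cases hΨw : (resample l (w.1, w.2.1)).2 = Ψ (resample l (w.1, w.2.1)).1
  swap
  · exact Or.inl ⟨hΨw, trivial⟩
  refine Or.inr (Set.mem_biUnion (Finset.mem_coe.2 (Finset.mem_range.2 hcK))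
    (Set.mem_biUnion (Finset.mem_coe.2 (Finset.mem_range.2 hyK)) ⟨?_, hc⟩))
  set e₁ := (resample l (w.1, w.2.1)).1 with he₁
  set f₁ := (resample l (w.1, w.2.1)).2 with hf₁'
  have hE : e₁ = qinv (cdf (condFst l f₁)) w.1 := by
    rw [← condQuantile_eq l hf₁]; rfl
  have hF : (resample g' (w.1, w.2.2)).1 = qinv (cdf (condFst g' c)) w.1 := by
    rw [hc] at he₂
    rw [← condQuantile_eq g' he₂, ← hc]; rfl
  rw [hc] at he₂
  have hT : ∃ t, 1 ≤ cdf (condFst g' c) t :=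
    ⟨K, one_le_cdf_condFst g' (by rw [hg'f]; exact hg₂) he₂⟩
  have hpred : qinv (cdf (condFst g' c)) w.1 ≠
      qinv (cdf (condFst g' c)) (cdf (condFst l f₁) (qinv (cdf (condFst l f₁)) w.1)) := by
    intro heq
    refine hne ?_
    have hx : (starMap l g' K w).1 = ((i * K + c : ℕ) : ℝ) := by
      have h2 : (resample g' (w.1, w.2.2)).2 = c := hc
      simp only [starMap]
      rw [← he₁, hi, h2]; push_cast; ring
    have hdiv : (i * K + c) / K = i := by
      rw [mul_comm, Nat.mul_add_div hK, Nat.div_eq_of_lt hcK, add_zero]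
    have hmod : (i * K + c) % K = c := by
      rw [mul_comm, Nat.mul_add_mod, Nat.mod_eq_of_lt hcK]
    have hΨ' : Ψ' (starMap l g' K w).1 = f₁ * K + (resample g' (w.1, w.2.2)).1 := by
      simp only [Ψ', hx, Nat.floor_natCast, hdiv, hmod]
      rw [← hi, ← hΨw, hF, heq, ← hE]
    exact hΨ'.symm
  change e₁ = qinv (cdf (condFst l f₁)) (cdf (condFst g' c) y)
  rw [← hy, hF, hE]
  exact eq_qinv_of_ne_predicted _ _ hw hT hpred

/-- The `t`-th moment of the mass that `μ` gives to a `μ`-random point. -/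
noncomputable def massMoment {α : Type*} [MeasurableSpace α] (t : ℝ) (μ : Measure α) : ℝ≥0∞ :=
  ∫⁻ x, μ {x} ^ t ∂μ

lemma measurable_measure_singleton {α : Type*} [MeasurableSpace α] [MeasurableEq α]
    (μ : Measure α) [SFinite μ] : Measurable fun x => μ {x} := by
  have h := measurable_measure_prodMk_left (ν := μ) (measurableSet_diagonal (α := α))
  have e : ∀ x : α, Prod.mk x ⁻¹' Set.diagonal α = {x} := by
    intro x; ext y; simp [eq_comm]
  simpa only [e] using h

lemma massMoment_map_of_injOn {α β : Type*} [MeasurableSpace α] [MeasurableSpace β]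
    [MeasurableEq β] [MeasurableSingletonClass β] (t : ℝ) (μ : Measure α) [IsFiniteMeasure μ]
    {f : α → β} (hf : Measurable f) {D : Set α} (hD : ∀ᵐ x ∂μ, x ∈ D) (hinj : Set.InjOn f D) :
    massMoment t (μ.map f) = massMoment t μ := by
  rw [massMoment, lintegral_map ((measurable_measure_singleton _).pow_const t) hf]
  refine lintegral_congr_ae ?_
  filter_upwards [hD] with x hx
  rw [Measure.map_apply hf (measurableSet_singleton _)]
  congr 1
  refine measure_congr ?_
  filter_upwards [hD] with y hy
  refine propext ⟨fun h => hinj hy hx h, fun h => ?_⟩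
  exact congrArg f h

lemma massMoment_prod {α β : Type*} [MeasurableSpace α] [MeasurableSpace β]
    [MeasurableEq α] [MeasurableEq β] (t : ℝ) (μ : Measure α) (ν : Measure β)
    [IsFiniteMeasure μ] [IsFiniteMeasure ν] :
    massMoment t (μ.prod ν) = massMoment t μ * massMoment t ν := by
  rw [massMoment, massMoment, massMoment, ← lintegral_prod_mul
    ((measurable_measure_singleton μ).pow_const t).aemeasurable
    ((measurable_measure_singleton ν).pow_const t).aemeasurable]
  refine lintegral_congr fun z => ?_
  rw [← ENNReal.mul_rpow_of_ne_top (measure_ne_top _ _) (measure_ne_top _ _), ← Measure.prod_prod,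
    Set.singleton_prod_singleton]

lemma massMoment_pi {E : Type*} [Fintype E] [MeasurableSpace E] [MeasurableSingletonClass E]
    (t : ℝ) (μ : Measure E) [IsFiniteMeasure μ] (m : ℕ) :
    massMoment t (Measure.pi fun _ : Fin m => μ) = massMoment t μ ^ m := by
  have hprod : ∀ x : Fin m → E, (∏ i, μ {x i}) ^ t = ∏ i, μ {x i} ^ t := fun x =>
    (ENNReal.prod_rpow_of_ne_top (fun i _ => measure_ne_top _ _) t).symm
  simp only [massMoment, lintegral_fintype, Measure.pi_singleton, hprod,
    ← Finset.prod_mul_distrib]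
  exact (Fintype.sum_pow (fun e => μ {e} ^ t * μ {e}) m).symm

lemma measure_rpow_le_of_massMoment_le {α : Type*} [MeasurableSpace α] [MeasurableEq α]
    (μ : Measure α) [IsFiniteMeasure μ] {t : ℝ} {c R : ℝ≥0∞} (hc0 : c ≠ 0) (hct : c ≠ ⊤)
    (hM : massMoment t μ ≤ R * c ^ t) : μ {x | c ^ t ≤ μ {x} ^ t} ≤ R := by
  have h0 : c ^ t ≠ 0 := (ENNReal.rpow_pos (pos_iff_ne_zero.2 hc0) hct).ne'
  have h1 : c ^ t ≠ ⊤ := ENNReal.rpow_ne_top_of_ne_zero hc0 hct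
  refine (meas_ge_le_lintegral_div
    ((measurable_measure_singleton μ).pow_const t).aemeasurable h0 h1).trans ?_
  exact ENNReal.div_le_of_le_mul hM

lemma measure_lt_mass_le {α : Type*} [MeasurableSpace α] [MeasurableEq α]
    (μ : Measure α) [IsFiniteMeasure μ] {t : ℝ} (ht : 0 < t) {c R : ℝ≥0∞} (hc0 : c ≠ 0)
    (hct : c ≠ ⊤) (hM : massMoment t μ ≤ R * c ^ t) : μ {x | c < μ {x}} ≤ R :=
  (measure_mono fun _ hx => ENNReal.rpow_le_rpow (le_of_lt hx) ht.le).trans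
    (measure_rpow_le_of_massMoment_le μ hc0 hct hM)

lemma measure_mass_lt_le {α : Type*} [MeasurableSpace α] [MeasurableEq α]
    (μ : Measure α) [IsFiniteMeasure μ] {t : ℝ} (ht : 0 < t) {c R : ℝ≥0∞} (hc0 : c ≠ 0)
    (hct : c ≠ ⊤) (hM : massMoment (-t) μ ≤ R * c ^ (-t)) : μ {x | μ {x} < c} ≤ R := by
  refine (measure_mono fun x hx => ?_).trans (measure_rpow_le_of_massMoment_le μ hc0 hct hM)
  simp only [Set.mem_ofPred_eq, ENNReal.rpow_neg] at hx ⊢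
  exact ENNReal.inv_le_inv.2 (ENNReal.rpow_le_rpow hx.le ht.le)

lemma measure_fst_eq_le (l : Measure (ℝ × ℝ)) [IsProbabilityMeasure l]
    (hl : NatCarried (l.map Prod.snd)) {c₁ c₂ R : ℝ≥0∞}
    (h₁ : l.map Prod.fst {x | c₁ < l.map Prod.fst {x}} ≤ R)
    (h₂ : l.map Prod.snd {y | l.map Prod.snd {y} < c₂} ≤ R) (hc : c₁ ≤ R * c₂) (h : ℝ → ℝ) :
    l {z | z.1 = h z.2} ≤ 3 * R := by
  classical
  have : IsProbabilityMeasure (l.map Prod.snd) :=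
    Measure.isProbabilityMeasure_map measurable_snd.aemeasurable
  let P : ℕ → Prop := fun k => l.map Prod.fst {h k} ≤ c₁ ∧ c₂ ≤ l.map Prod.snd {(k : ℝ)}
  let s : ℕ → Set (ℝ × ℝ) := fun k => if P k then {(h k, (k : ℝ))} else ∅
  have hs : ∀ k, l (s k) ≤ R * l.map Prod.snd {(k : ℝ)} := by
    intro k
    by_cases hk : P k
    · simp only [s, if_pos hk]
      calc l {(h k, (k : ℝ))} ≤ l (Prod.fst ⁻¹' {h k}) :=
            measure_mono (by rintro _ rfl; rfl)
        _ = l.map Prod.fst {h k} :=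
            (Measure.map_apply measurable_fst (measurableSet_singleton _)).symm
        _ ≤ c₁ := hk.1
        _ ≤ R * c₂ := hc
        _ ≤ _ := by gcongr; exact hk.2
    · simp [s, if_neg hk]
  have hsub : {z : ℝ × ℝ | z.1 = h z.2} ⊆ Prod.fst ⁻¹' {x | c₁ < l.map Prod.fst {x}} ∪
      (Prod.snd ⁻¹' {y | l.map Prod.snd {y} < c₂} ∪
        ({z | ¬ ∃ k : ℕ, z.2 = (k : ℝ)} ∪ ⋃ k, s k)) := by
    rintro ⟨x, y⟩ hz
    by_cases h1 : c₁ < l.map Prod.fst {x}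
    · exact Or.inl h1
    by_cases h2 : l.map Prod.snd {y} < c₂
    · exact Or.inr (Or.inl h2)
    by_cases h3 : ∃ k : ℕ, y = (k : ℝ)
    · obtain ⟨k, rfl⟩ := h3
      obtain rfl : x = h k := hz
      refine Or.inr (Or.inr (Or.inr (Set.mem_iUnion.2 ⟨k, ?_⟩)))
      have hk : P k := ⟨not_lt.1 h1, not_lt.1 h2⟩
      simp [s, if_pos hk]
    · exact Or.inr (Or.inr (Or.inl h3))
  have hnat : l {z | ¬ ∃ k : ℕ, z.2 = (k : ℝ)} = 0 := ae_of_ae_map measurable_snd.aemeasurable hl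
  have hsum : l (⋃ k, s k) ≤ R := by
    calc l (⋃ k, s k) ≤ ∑' k, l (s k) := measure_iUnion_le _
      _ ≤ ∑' k : ℕ, R * l.map Prod.snd {(k : ℝ)} := ENNReal.tsum_le_tsum hs
      _ = R * ∑' k : ℕ, l.map Prod.snd {(k : ℝ)} := ENNReal.tsum_mul_left
      _ ≤ R * 1 := by
        gcongr
        refine (tsum_meas_le_meas_iUnion_of_disjoint _ (fun k => measurableSet_singleton _)
          fun i j hij => ?_).trans prob_le_one
        simpa using hij
      _ = R := mul_one R
  calc l {z | z.1 = h z.2} ≤ _ := measure_mono hsub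
    _ ≤ R + (R + (0 + R)) := by
      refine (measure_union_le _ _).trans (add_le_add ?_ ((measure_union_le _ _).trans
        (add_le_add ?_ ((measure_union_le _ _).trans (add_le_add hnat.le hsum)))))
      · exact (Measure.le_map_apply measurable_fst.aemeasurable _).trans h₁
      · exact (Measure.le_map_apply measurable_snd.aemeasurable _).trans h₂
    _ = 3 * R := by ring

lemma eventually_sum_mul_exp_le {E : Type*} [Fintype E] (w c : E → ℝ) (hw : ∑ e, w e = 1)
    {s : ℝ} (hs : ∑ e, w e * c e < s) :
    ∀ᶠ t in nhdsWithin (0 : ℝ) (Set.Ioi 0), ∑ e, w e * Real.exp (t * c e) ≤ Real.exp (t * s) := by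
  let D : ℝ → ℝ := fun t => Real.exp (t * s) - ∑ e, w e * Real.exp (t * c e)
  have hexp : ∀ b : ℝ, HasDerivAt (fun t : ℝ => Real.exp (t * b)) b 0 := fun b => by
    simpa using ((hasDerivAt_id (0 : ℝ)).mul_const b).exp
  have hD : HasDerivAt D (s - ∑ e, w e * c e) 0 :=
    (hexp s).sub (HasDerivAt.fun_sum fun e _ => (hexp (c e)).const_mul (w e))
  have h0 : D 0 = 0 := by simp [D, hw]
  have hslope := (hasDerivAt_iff_tendsto_slope.1 hD).eventually_const_lt (sub_pos.2 hs)
  filter_upwards [nhdsWithin_mono (0 : ℝ) (fun t (ht : 0 < t) => ht.ne') hslope,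
    self_mem_nhdsWithin] with t ht ht0
  have ht0' : 0 < t := ht0
  rw [slope_def_field, h0, sub_zero, sub_zero] at ht
  have : 0 < D t := by
    by_contra! hneg
    exact absurd ht (not_lt.2 (div_nonpos_of_nonpos_of_nonneg hneg ht0'.le))
  exact (sub_pos.1 this).le

lemma massMoment_eq_ofReal {E : Type*} [Fintype E] [MeasurableSpace E]
    [MeasurableSingletonClass E] (μ : Measure E) [IsFiniteMeasure μ] (t : ℝ) :
    massMoment t μ =
      ENNReal.ofReal (∑ e, (μ {e}).toReal * Real.exp (t * Real.log (μ {e}).toReal)) := by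
  rw [massMoment, lintegral_fintype, ENNReal.ofReal_sum_of_nonneg fun e _ => by positivity]
  refine Finset.sum_congr rfl fun e _ => ?_
  by_cases h : μ {e} = 0
  · simp [h]
  have hpos : 0 < (μ {e}).toReal := ENNReal.toReal_pos h (measure_ne_top _ _)
  rw [ENNReal.ofReal_mul hpos.le, ENNReal.ofReal_toReal (measure_ne_top _ _), mul_comm, mul_comm t,
    ← Real.rpow_def_of_pos hpos, ← ENNReal.ofReal_rpow_of_pos hpos,
    ENNReal.ofReal_toReal (measure_ne_top _ _)]

lemma sum_toReal_singleton {E : Type*} [Fintype E] [MeasurableSpace E]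
    [MeasurableSingletonClass E] (μ : Measure E) [IsProbabilityMeasure μ] :
    ∑ e, (μ {e}).toReal = 1 := by
  rw [← ENNReal.toReal_sum fun e _ => measure_ne_top _ _, sum_measure_singleton]
  simp

lemma exists_massMoment_gap {E F : Type*} [Fintype E] [MeasurableSpace E]
    [MeasurableSingletonClass E] [Fintype F] [MeasurableSpace F] [MeasurableSingletonClass F]
    (μ : Measure E) (ν : Measure F) [IsProbabilityMeasure μ] [IsProbabilityMeasure ν]
    (h : entropyOf ν < entropyOf μ) :
    ∃ (t : ℝ) (c₁ c₂ r : ℝ≥0∞), 0 < t ∧ c₁ ≠ 0 ∧ c₁ ≠ ⊤ ∧ c₂ ≠ 0 ∧ c₂ ≠ ⊤ ∧ r < 1 ∧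
      massMoment t μ ≤ r * c₁ ^ t ∧ massMoment (-t) ν ≤ r * c₂ ^ (-t) ∧ c₁ ≤ r * c₂ := by
  obtain ⟨d, hd⟩ : ∃ d, d = (entropyOf μ - entropyOf ν) / 5 := ⟨_, rfl⟩
  have hd0 : 0 < d := by rw [hd]; linarith
  have e₁ := eventually_sum_mul_exp_le (fun e => (μ {e}).toReal)
    (fun e => Real.log (μ {e}).toReal) (sum_toReal_singleton μ) (s := -(entropyOf μ - d))
    (by simp only [entropyOf]; linarith)
  have e₂ := eventually_sum_mul_exp_le (fun e => (ν {e}).toReal)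
    (fun e => -Real.log (ν {e}).toReal) (sum_toReal_singleton ν) (s := entropyOf ν + d)
    (by simp only [entropyOf, mul_neg, Finset.sum_neg_distrib]; linarith)
  have e₃ : ∀ᶠ t in nhdsWithin (0 : ℝ) (Set.Ioi 0), t < 1 :=
    nhdsWithin_le_nhds (eventually_lt_nhds one_pos)
  obtain ⟨t, ⟨⟨h₁, h₂⟩, h₃⟩, ht⟩ := (((e₁.and e₂).and e₃).and self_mem_nhdsWithin).exists
  have ht0 : 0 < t := ht
  have hne0 : ∀ x, ENNReal.ofReal (Real.exp x) ≠ 0 := fun x => by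
    simp [Real.exp_pos]
  have hpow : ∀ x s : ℝ, ENNReal.ofReal (Real.exp x) ^ s = ENNReal.ofReal (Real.exp (x * s)) :=
    fun x s => by rw [ENNReal.ofReal_rpow_of_pos (Real.exp_pos _), ← Real.exp_mul]
  have hmul : ∀ x y, ENNReal.ofReal (Real.exp x) * ENNReal.ofReal (Real.exp y) =
      ENNReal.ofReal (Real.exp (x + y)) :=
    fun x y => by rw [← ENNReal.ofReal_mul (Real.exp_pos _).le, Real.exp_add]
  refine ⟨t, ENNReal.ofReal (Real.exp (-(entropyOf μ - 2 * d))),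
    ENNReal.ofReal (Real.exp (-(entropyOf ν + 2 * d))), ENNReal.ofReal (Real.exp (-(t * d))),
    ht0, hne0 _, ENNReal.ofReal_ne_top, hne0 _, ENNReal.ofReal_ne_top, ?_, ?_, ?_, ?_⟩
  · rw [ENNReal.ofReal_lt_one, Real.exp_lt_one_iff]
    nlinarith
  · rw [massMoment_eq_ofReal, hpow, hmul]
    refine ENNReal.ofReal_le_ofReal (h₁.trans (Real.exp_le_exp.2 ?_))
    linarith
  · rw [massMoment_eq_ofReal, hpow, hmul]
    simp only [mul_neg, neg_mul] at h₂ ⊢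
    refine ENNReal.ofReal_le_ofReal (h₂.trans (Real.exp_le_exp.2 ?_))
    linarith
  · rw [hmul]
    refine ENNReal.ofReal_le_ofReal (Real.exp_le_exp.2 ?_)
    nlinarith

/-- A nonnegative matrix can be replaced by one with the same row and column sums, no larger
support, and few rows having more than one nonzero entry. -/
lemma exists_sparse_coupling {X Y : Type*} [Fintype X] [Fintype Y] [Nonempty Y] (w : X → Y → ℝ)
    (hw : ∀ x y, 0 ≤ w x y) (T : Finset Y) (hT : ∀ x, ∀ y ∉ T, w x y = 0) :
    ∃ w' : X → Y → ℝ, (∀ x y, 0 ≤ w' x y) ∧ (∀ x y, w x y = 0 → w' x y = 0) ∧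
      (∀ x, ∑ y, w' x y = ∑ y, w x y) ∧ (∀ y, ∑ x, w' x y = ∑ x, w x y) ∧
      ∃ B : Finset X, B.card ≤ 2 * T.card ∧ (∀ x ∈ B, 0 < ∑ y, w x y) ∧
        ∃ Ψ : X → Y, ∀ x ∉ B, ∀ y, w' x y ≠ 0 → y = Ψ x := by
  classical
  have hrow : ∀ x, 0 ≤ ∑ y, w x y := fun x => Finset.sum_nonneg fun y _ => hw x y
  rcases (Finset.sum_nonneg fun x (_ : x ∈ Finset.univ) => hrow x).eq_or_lt with hM | hM
  · have hz : ∀ x y, w x y = 0 := fun x y => by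
      have h1 := (Finset.sum_eq_zero_iff_of_nonneg fun x _ => hrow x).1 hM.symm x
        (Finset.mem_univ x)
      exact (Finset.sum_eq_zero_iff_of_nonneg fun y _ => hw x y).1 h1 y (Finset.mem_univ y)
    exact ⟨w, hw, fun _ _ => id, fun _ => rfl, fun _ => rfl, ∅, by simp, by simp,
      fun _ => Classical.arbitrary Y, fun x _ y h => absurd (hz x y) h⟩
  set M := ∑ x, ∑ y, w x y
  let S : Finset X := {x | 0 < ∑ y, w x y}
  let pt : X × Y → (S → ℝ) × (T → ℝ) := fun z =>
    (fun x => if z.1 = x then 1 else 0, fun y => if z.2 = y then 1 else 0)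
  let v : (S → ℝ) × (T → ℝ) := (fun x => (∑ y, w x y) / M, fun y => (∑ x, w x y) / M)
  have hS : ∀ x y, 0 < w x y → x ∈ S := fun x y h => by
    simpa [S] using h.trans_le (Finset.single_le_sum (fun y _ => hw x y) (Finset.mem_univ y))
  have hTmem : ∀ x y, 0 < w x y → y ∈ T := fun x y h => by
    by_contra hy
    exact h.ne' (hT x y hy)
  let P : Finset (X × Y) := {z | 0 < w z.1 z.2}
  have hPsum : ∀ f : X × Y → ℝ, ∑ z ∈ P, w z.1 z.2 * f z = ∑ x, ∑ y, w x y * f (x, y) := by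
    intro f
    rw [← Fintype.sum_prod_type' (f := fun x y => w x y * f (x, y))]
    refine Finset.sum_subset (Finset.subset_univ _) fun z _ hz => ?_
    have : w z.1 z.2 = 0 := le_antisymm (by simpa [P] using hz) (hw _ _)
    simp [this]
  have hPM : ∑ z ∈ P, w z.1 z.2 = M := by simpa using hPsum fun _ => 1
  have hv : v ∈ convexHull ℝ (pt '' P) := by
    have hc := Finset.centerMass_mem_convexHull (R := ℝ) P (w := fun z => w z.1 z.2) (z := pt)
      (s := pt '' P) (fun z _ => hw _ _) (by rw [hPM]; exact hM)
      fun z hz => Set.mem_image_of_mem _ hz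
    convert hc using 1
    rw [Finset.centerMass, hPM]
    refine Prod.ext (funext fun x => ?_) (funext fun y => ?_)
    · simp only [v, pt, Prod.smul_fst, Prod.fst_sum, Pi.smul_apply, Finset.sum_apply, smul_eq_mul]
      rw [hPsum fun z => if z.1 = x then 1 else 0]
      simp [div_eq_inv_mul]
    · simp only [v, pt, Prod.smul_snd, Prod.snd_sum, Pi.smul_apply, Finset.sum_apply, smul_eq_mul]
      rw [hPsum fun z => if z.2 = y then 1 else 0]
      simp [div_eq_inv_mul]
  obtain ⟨ι, _, z, c, hz, haff, hc0, -, hcz⟩ := eq_pos_convex_span_of_mem_convexHull hv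
  have hz' : ∀ i, ∃ e : X × Y, 0 < w e.1 e.2 ∧ pt e = z i := fun i => by
    obtain ⟨e, he, hez⟩ := hz (Set.mem_range_self i)
    exact ⟨e, by simpa [P] using he, hez⟩
  choose e he hez using hz'
  let w' : X → Y → ℝ := fun x y => M * ∑ i, if e i = (x, y) then c i else 0
  have hfst : ∀ x, ∑ y, w' x y = M * ∑ i, if (e i).1 = x then c i else 0 := fun x => by
    simp only [w', ← Finset.mul_sum]
    rw [Finset.sum_comm]
    congr 1
    refine Finset.sum_congr rfl fun i _ => ?_
    simp only [Prod.ext_iff, ite_and]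
    by_cases h : (e i).1 = x <;> simp [h]
  have hsnd : ∀ y, ∑ x, w' x y = M * ∑ i, if (e i).2 = y then c i else 0 := fun y => by
    simp only [w', ← Finset.mul_sum]
    rw [Finset.sum_comm]
    congr 1
    refine Finset.sum_congr rfl fun i _ => ?_
    simp only [Prod.ext_iff, and_comm (a := (e i).1 = _), ite_and]
    by_cases h : (e i).2 = y <;> simp [h]
  have hrowS : ∀ x ∈ S, M * ∑ i, (if (e i).1 = x then c i else 0) = ∑ y, w x y := fun x hx => by
    have h := congrFun (congrArg Prod.fst hcz) ⟨x, hx⟩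
    simp only [← hez, v, pt, Prod.smul_fst, Prod.fst_sum, Pi.smul_apply, Finset.sum_apply,
      smul_eq_mul, mul_ite, mul_one, mul_zero] at h
    rw [h]
    field_simp
  have hcolT : ∀ y ∈ T, M * ∑ i, (if (e i).2 = y then c i else 0) = ∑ x, w x y := fun y hy => by
    have h := congrFun (congrArg Prod.snd hcz) ⟨y, hy⟩
    simp only [← hez, v, pt, Prod.smul_snd, Prod.snd_sum, Pi.smul_apply, Finset.sum_apply,
      smul_eq_mul, mul_ite, mul_one, mul_zero] at h
    rw [h]
    field_simp
  -- rows with at least two nonzero entries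
  let B : Finset X := {x | ∃ i j, (e i).1 = x ∧ (e j).1 = x ∧ i ≠ j}
  have hBS : B ⊆ S := fun x hx => by
    obtain ⟨i, -, rfl, -⟩ := (Finset.mem_filter.1 hx).2
    exact hS _ _ (he i)
  have hfib : ∀ x ∈ S, (if x ∈ B then 2 else 1) ≤ (Finset.univ.filter fun i => (e i).1 = x).card :=
    fun x hx => by
      split_ifs with hB
      · obtain ⟨i, j, hi, hj, hij⟩ := (Finset.mem_filter.1 hB).2
        exact Finset.one_lt_card.2 ⟨i, by simp [hi], j, by simp [hj], hij⟩
      · rw [Nat.one_le_iff_ne_zero, Finset.card_ne_zero]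
        by_contra hne
        rw [Finset.not_nonempty_iff_eq_empty, Finset.filter_eq_empty_iff] at hne
        have h := hrowS x hx
        rw [Finset.sum_eq_zero fun i hi => if_neg (hne hi), mul_zero] at h
        exact (Finset.mem_filter.1 hx).2.ne h
  have hcard : S.card + B.card ≤ Fintype.card ι := by
    calc S.card + B.card = ∑ x ∈ S, if x ∈ B then 2 else 1 := by
          have : ∀ x ∈ S, (if x ∈ B then 2 else 1) = 1 + if x ∈ B then 1 else 0 := fun x _ => by
            split_ifs <;> rfl
          rw [Finset.sum_congr rfl this, Finset.sum_add_distrib, Finset.sum_ite_mem,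
            Finset.inter_eq_right.2 hBS]
          simp
      _ ≤ ∑ x ∈ S, (Finset.univ.filter fun i => (e i).1 = x).card := Finset.sum_le_sum hfib
      _ = Fintype.card ι :=
          (Finset.card_eq_sum_card_fiberwise fun i _ => hS _ _ (he i)).symm
  have hdim : Fintype.card ι ≤ S.card + T.card + 1 := by
    refine haff.card_le_finrank_succ.trans (Nat.succ_le_succ ((Submodule.finrank_le _).trans ?_))
    simp [Module.finrank_prod]
  have hTpos : 0 < T.card := by
    rw [Finset.card_pos]
    by_contra hne
    rw [Finset.not_nonempty_iff_eq_empty] at hne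
    refine hM.ne' (Finset.sum_eq_zero fun x _ => Finset.sum_eq_zero fun y _ => hT x y ?_)
    simp [hne]
  refine ⟨w', fun x y => mul_nonneg hM.le (Finset.sum_nonneg fun i _ => ?_), fun x y hxy => ?_,
    fun x => ?_, fun y => ?_, B, by omega, fun x hx => (Finset.mem_filter.1 (hBS hx)).2, ?_⟩
  · split_ifs
    exacts [(hc0 i).le, le_rfl]
  · simp only [w']
    rw [Finset.sum_eq_zero, mul_zero]
    intro i _
    refine if_neg fun h => (he i).ne' ?_
    rw [h]
    exact hxy
  · rw [hfst]
    by_cases hx : x ∈ S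
    · exact hrowS x hx
    · have hne : ∀ i, (e i).1 ≠ x := fun i h => hx (h ▸ hS _ _ (he i))
      rw [Finset.sum_eq_zero fun i _ => if_neg (hne i), mul_zero]
      exact (le_antisymm (by simpa [S] using hx) (hrow x)).symm
  · rw [hsnd]
    by_cases hy : y ∈ T
    · exact hcolT y hy
    · have hne : ∀ i, (e i).2 ≠ y := fun i h => hy (h ▸ hTmem _ _ (he i))
      rw [Finset.sum_eq_zero fun i _ => if_neg (hne i), mul_zero]
      exact (Finset.sum_eq_zero fun x _ => hT x y hy).symm
  · refine ⟨fun x => if h : ∃ i, (e i).1 = x then (e h.choose).2 else Classical.arbitrary Y,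
      fun x hx y hy => ?_⟩
    have : ∃ i, e i = (x, y) := by
      by_contra! hne
      exact hy (by simp [w', hne])
    obtain ⟨i, hi⟩ := this
    have hex : ∃ i, (e i).1 = x := ⟨i, by rw [hi]⟩
    have hij : hex.choose = i := by
      by_contra hne
      exact hx (Finset.mem_filter.2 ⟨Finset.mem_univ _, _, _, hex.choose_spec, by rw [hi], hne⟩)
    simp only [dif_pos hex]
    rw [hij, hi]

lemma map_fst_singleton_eq_sum {X Y : Type*} [MeasurableSpace X] [MeasurableSpace Y] [Fintype Y]
    [MeasurableSingletonClass X] [MeasurableSingletonClass Y] (γ : Measure (X × Y)) (x : X) :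
    γ.map Prod.fst {x} = ∑ y, γ {(x, y)} := by
  rw [Measure.map_apply measurable_fst (measurableSet_singleton x)]
  have h := sum_measure_singleton (μ := γ)
    (s := Finset.univ.map ⟨fun y : Y => (x, y), Prod.mk_right_injective x⟩)
  rw [Finset.sum_map] at h
  refine Eq.trans ?_ h.symm
  congr 1
  ext ⟨a, b⟩
  simp [eq_comm]

lemma map_snd_singleton_eq_sum {X Y : Type*} [MeasurableSpace X] [MeasurableSpace Y] [Fintype X]
    [MeasurableSingletonClass X] [MeasurableSingletonClass Y] (γ : Measure (X × Y)) (y : Y) :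
    γ.map Prod.snd {y} = ∑ x, γ {(x, y)} := by
  rw [Measure.map_apply measurable_snd (measurableSet_singleton y)]
  have h := sum_measure_singleton (μ := γ)
    (s := Finset.univ.map ⟨fun x : X => (x, y), Prod.mk_left_injective y⟩)
  rw [Finset.sum_map] at h
  refine Eq.trans ?_ h.symm
  congr 1
  ext ⟨a, b⟩
  simp [eq_comm]

lemma exists_coupling_of_weights {X Y : Type*} [MeasurableSpace X] [MeasurableSpace Y]
    [Fintype X] [Fintype Y] [MeasurableSingletonClass X] [MeasurableSingletonClass Y]
    (γ : Measure (X × Y)) [IsProbabilityMeasure γ] (W : X → Y → ℝ) (hW : ∀ x y, 0 ≤ W x y)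
    (hrow : ∀ x, ∑ y, W x y = ∑ y, γ.real {(x, y)})
    (hcol : ∀ y, ∑ x, W x y = ∑ x, γ.real {(x, y)}) :
    ∃ β : Measure (X × Y), IsProbabilityMeasure β ∧
      (∀ x y, β {(x, y)} = ENNReal.ofReal (W x y)) ∧
      β.map Prod.fst = γ.map Prod.fst ∧ β.map Prod.snd = γ.map Prod.snd := by
  let β : Measure (X × Y) := Measure.count.withDensity fun z => ENNReal.ofReal (W z.1 z.2)
  have hβ : ∀ x y, β {(x, y)} = ENNReal.ofReal (W x y) := fun x y => by
    simp [β, withDensity_apply _ (measurableSet_singleton _)]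
  have hfst : β.map Prod.fst = γ.map Prod.fst := by
    refine Measure.ext_of_singleton fun x => ?_
    simp only [map_fst_singleton_eq_sum, hβ]
    rw [← ENNReal.ofReal_sum_of_nonneg fun y _ => hW x y, hrow,
      ENNReal.ofReal_sum_of_nonneg fun y _ => measureReal_nonneg]
    exact Finset.sum_congr rfl fun y _ => ofReal_measureReal
  have hsnd : β.map Prod.snd = γ.map Prod.snd := by
    refine Measure.ext_of_singleton fun y => ?_
    simp only [map_snd_singleton_eq_sum, hβ]
    rw [← ENNReal.ofReal_sum_of_nonneg fun x _ => hW x y, hcol,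
      ENNReal.ofReal_sum_of_nonneg fun x _ => measureReal_nonneg]
    exact Finset.sum_congr rfl fun x _ => ofReal_measureReal
  refine ⟨β, ⟨?_⟩, hβ, hfst, hsnd⟩
  have h := congrArg (fun ρ : Measure X => ρ Set.univ) hfst
  simpa [Measure.map_apply measurable_fst MeasurableSet.univ] using h

/-- A coupling whose first marginal has mostly small atoms and whose second marginal has mostly
larger atoms can be replaced by an absolutely continuous one that is almost a graph. -/
lemma exists_almost_graph_coupling {X Y : Type*} [MeasurableSpace X] [MeasurableSpace Y]
    [Fintype X] [Fintype Y] [MeasurableSingletonClass X] [MeasurableSingletonClass Y]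
    (γ : Measure (X × Y)) [IsProbabilityMeasure γ] {c₁ c₂ R : ℝ≥0∞}
    (h₁ : γ.map Prod.fst {x | c₁ < γ.map Prod.fst {x}} ≤ R)
    (h₂ : γ.map Prod.snd {y | γ.map Prod.snd {y} < c₂} ≤ R) (hc : c₁ ≤ R * c₂) :
    ∃ β : Measure (X × Y), IsProbabilityMeasure β ∧ (∀ z, γ {z} = 0 → β {z} = 0) ∧
      β.map Prod.fst = γ.map Prod.fst ∧ β.map Prod.snd = γ.map Prod.snd ∧
      ∃ Ψ : X → Y, β {z | z.2 ≠ Ψ z.1} ≤ 4 * R := by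
  classical
  have : Nonempty (X × Y) := nonempty_of_isProbabilityMeasure γ
  have : Nonempty Y := this.map Prod.snd
  have : IsProbabilityMeasure (γ.map Prod.snd) :=
    Measure.isProbabilityMeasure_map measurable_snd.aemeasurable
  let T : Finset Y := {y | c₂ ≤ γ.map Prod.snd {y}}
  let G : X × Y → Prop := fun z => γ.map Prod.fst {z.1} ≤ c₁ ∧ z.2 ∈ T
  let w : X → Y → ℝ := fun x y => if G (x, y) then γ.real {(x, y)} else 0
  let g : X → Y → ℝ := fun x y => if G (x, y) then 0 else γ.real {(x, y)}
  have hw : ∀ x y, 0 ≤ w x y := fun x y => by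
    simp only [w]; split_ifs <;> positivity
  have hg : ∀ x y, 0 ≤ g x y := fun x y => by
    simp only [g]; split_ifs <;> positivity
  have hwg : ∀ x y, w x y + g x y = γ.real {(x, y)} := fun x y => by
    simp only [w, g]; split_ifs <;> simp
  obtain ⟨w', hw', hsub, hrow, hcol, B, hB, hBpos, Ψ, hΨ⟩ :=
    exists_sparse_coupling w hw T fun x y hy => if_neg fun h => hy h.2
  obtain ⟨β, hβ, hβW, hβ₁, hβ₂⟩ := exists_coupling_of_weights γ (fun x y => w' x y + g x y)
    (fun x y => add_nonneg (hw' x y) (hg x y))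
    (fun x => by simp only [← hwg, Finset.sum_add_distrib, hrow])
    (fun y => by simp only [← hwg, Finset.sum_add_distrib, hcol])
  refine ⟨β, hβ, fun z hz => ?_, hβ₁, hβ₂, Ψ, ?_⟩
  · have h0 : γ.real {(z.1, z.2)} = 0 := by simp [Measure.real, hz]
    have h := hwg z.1 z.2
    have hw0 : w z.1 z.2 = 0 := by linarith [hw z.1 z.2, hg z.1 z.2]
    have hg0 : g z.1 z.2 = 0 := by linarith [hw z.1 z.2, hg z.1 z.2]
    have := hβW z.1 z.2
    rwa [hsub _ _ hw0, hg0, add_zero, ENNReal.ofReal_zero] at this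
  have hTc : T.card * c₂ ≤ 1 := by
    calc (T.card : ℝ≥0∞) * c₂ = ∑ y ∈ T, c₂ := by simp
      _ ≤ ∑ y ∈ T, γ.map Prod.snd {y} :=
        Finset.sum_le_sum fun y hy => (Finset.mem_filter.1 hy).2
      _ ≤ 1 := by rw [sum_measure_singleton]; exact prob_le_one
  have hrowB : ∀ x ∈ B, ∑ y, ENNReal.ofReal (w' x y) ≤ c₁ := fun x hx => by
    rw [← ENNReal.ofReal_sum_of_nonneg fun y _ => hw' x y, hrow]
    have htyp : γ.map Prod.fst {x} ≤ c₁ := by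
      by_contra hx'
      refine (hBpos x hx).ne' (Finset.sum_eq_zero fun y _ => if_neg fun h => hx' h.1)
    refine le_trans ?_ htyp
    rw [map_fst_singleton_eq_sum, ENNReal.ofReal_sum_of_nonneg fun y _ => hw x y]
    refine Finset.sum_le_sum fun y _ => ENNReal.ofReal_le_of_le_toReal ?_
    have := hwg x y
    have := hg x y
    simp only [Measure.real] at *
    linarith
  have hatyp : ∑ z : X × Y, ENNReal.ofReal (g z.1 z.2) ≤ 2 * R := by
    calc ∑ z : X × Y, ENNReal.ofReal (g z.1 z.2) = ∑ z with ¬ G z, γ {z} := by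
          rw [Finset.sum_filter]
          refine Finset.sum_congr rfl fun z _ => ?_
          by_cases hz : G z
          · simp [g, hz]
          · simp [g, hz]
      _ = γ {z | ¬ G z} := by rw [sum_measure_singleton]; simp
      _ ≤ γ (Prod.fst ⁻¹' {x | c₁ < γ.map Prod.fst {x}} ∪
            Prod.snd ⁻¹' {y | γ.map Prod.snd {y} < c₂}) := by
          refine measure_mono fun z hz => ?_
          by_contra hz'
          simp only [Set.mem_union, Set.mem_preimage, Set.mem_ofPred_eq, not_or, not_lt] at hz'
          exact hz ⟨hz'.1, by simpa [T] using hz'.2⟩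
      _ ≤ R + R := (measure_union_le _ _).trans (add_le_add
          ((Measure.le_map_apply measurable_fst.aemeasurable _).trans h₁)
          ((Measure.le_map_apply measurable_snd.aemeasurable _).trans h₂))
      _ = 2 * R := (two_mul R).symm
  calc β {z | z.2 ≠ Ψ z.1} = ∑ z with z.2 ≠ Ψ z.1, β {z} := by
        rw [sum_measure_singleton]; simp
    _ ≤ ∑ z : X × Y, ((if z.1 ∈ B then ENNReal.ofReal (w' z.1 z.2) else 0) +
          ENNReal.ofReal (g z.1 z.2)) := by
        rw [Finset.sum_filter]
        refine Finset.sum_le_sum fun z _ => ?_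
        split_ifs with h1 h2 h2
        · exact (hβW z.1 z.2).le.trans ENNReal.ofReal_add_le
        · have : w' z.1 z.2 = 0 := by
            by_contra h
            exact h1 (hΨ z.1 h2 z.2 h)
          have h := hβW z.1 z.2
          rw [this, zero_add] at h
          rw [zero_add]
          exact h.le
        · exact zero_le
        · exact zero_le
    _ = ∑ x ∈ B, ∑ y, ENNReal.ofReal (w' x y) + ∑ z : X × Y, ENNReal.ofReal (g z.1 z.2) := by
        rw [Finset.sum_add_distrib, Fintype.sum_prod_type]
        congr 1
        rw [← Finset.univ_inter B, ← Finset.sum_ite_mem, Finset.univ_inter]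
        refine Finset.sum_congr rfl fun x _ => ?_
        by_cases hx : x ∈ B <;> simp [hx]
    _ ≤ B.card * c₁ + 2 * R := by
        gcongr
        simpa using Finset.sum_le_sum hrowB
    _ ≤ (2 * T.card : ℕ) * (R * c₂) + 2 * R := by gcongr
    _ = 2 * R * (T.card * c₂) + 2 * R := by push_cast; ring
    _ ≤ 2 * R * 1 + 2 * R := by gcongr
    _ = 4 * R := by ring

lemma ENNReal.mul_rpow_pow (r c : ℝ≥0∞) (t : ℝ) (k : ℕ) :
    (r * c ^ t) ^ k = r ^ k * (c ^ k) ^ t := by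
  rw [mul_pow, ← ENNReal.rpow_natCast (c ^ t), ← ENNReal.rpow_natCast c, ← ENNReal.rpow_mul,
    ← ENNReal.rpow_mul, mul_comm t]

lemma massMoment_map_pairBase (t : ℝ) {α α' : Measure ℝ} [IsProbabilityMeasure α]
    [IsProbabilityMeasure α'] {K : ℕ} (hα : NatCarried α) (hα' : NatCarriedBelow α' K) :
    massMoment t ((α.prod α').map (pairBase K)) = massMoment t α * massMoment t α' := by
  rw [massMoment_map_of_injOn t _ (measurable_pairBase _)
    (D := {x | (∃ k : ℕ, x.1 = (k : ℝ)) ∧ ∃ k < K, x.2 = (k : ℝ)}), massMoment_prod]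
  · filter_upwards [Measure.quasiMeasurePreserving_fst.ae hα,
      Measure.quasiMeasurePreserving_snd.ae hα'] with x h1 h2
    exact ⟨h1, h2⟩
  · rintro ⟨_, _⟩ ⟨⟨i, rfl⟩, ⟨j, hj, rfl⟩⟩ ⟨_, _⟩ ⟨⟨i', rfl⟩, ⟨j', hj', rfl⟩⟩ h
    have h' : K * i + j = K * i' + j' := by
      simp only [pairBase] at h
      rw [mul_comm K, mul_comm K]
      exact_mod_cast h
    have hK : 0 < K := by omega
    have hi : i = i' := by
      have := congrArg (· / K) h'
      simpa [Nat.mul_add_div hK, Nat.div_eq_of_lt hj, Nat.div_eq_of_lt hj'] using this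
    subst hi
    obtain rfl : j = j' := by omega
    rfl

lemma exists_predictor_iterStar (l g : Measure (ℝ × ℝ)) [IsProbabilityMeasure l]
    [IsProbabilityMeasure g] {K m : ℕ} (hl₁ : NatCarried (l.map Prod.fst))
    (hl₂ : NatCarried (l.map Prod.snd)) (hg₁ : NatCarriedBelow (g.map Prod.fst) K)
    (hg₂ : NatCarriedBelow (g.map Prod.snd) K) {t : ℝ} {c₁ c₂ r δ : ℝ≥0∞} (ht : 0 < t)
    (hc₁ : c₁ ≠ 0) (hc₁' : c₁ ≠ ⊤) (hc₂ : c₂ ≠ 0) (hc₂' : c₂ ≠ ⊤) (hc : c₁ ≤ r * c₂)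
    (hgm₁ : massMoment t (g.map Prod.fst) ≤ r * c₁ ^ t)
    (hgm₂ : massMoment (-t) (g.map Prod.snd) ≤ r * c₂ ^ (-t))
    (hlm₁ : massMoment t (l.map Prod.fst) ≤ (r * c₁ ^ t) ^ m)
    (hlm₂ : massMoment (-t) (l.map Prod.snd) ≤ (r * c₂ ^ (-t)) ^ m)
    {Ψ : ℝ → ℝ} (hΨ : l {z | z.2 ≠ Ψ z.1} ≤ δ) (n : ℕ) :
    IsProbabilityMeasure (iterStar l g K n) ∧ NatCarried ((iterStar l g K n).map Prod.fst) ∧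
      NatCarried ((iterStar l g K n).map Prod.snd) ∧
      massMoment t ((iterStar l g K n).map Prod.fst) ≤ (r * c₁ ^ t) ^ (m + n) ∧
      massMoment (-t) ((iterStar l g K n).map Prod.snd) ≤ (r * c₂ ^ (-t)) ^ (m + n) ∧
      ∃ Ψ' : ℝ → ℝ, iterStar l g K n {z | z.2 ≠ Ψ' z.1} ≤
        δ + ∑ i ∈ Finset.range n, K * (3 * r ^ (m + i)) := by
  induction n with
  | zero => exact ⟨‹_›, hl₁, hl₂, hlm₁, hlm₂, Ψ, by simpa [iterStar] using hΨ⟩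
  | succ n ih =>
    obtain ⟨hP, h₁, h₂, hm₁, hm₂, Ψ', hΨ'⟩ := ih
    set l' := iterStar l g K n
    have hstep : iterStar l g K (n + 1) = starJoin l' g K := rfl
    have hfst := map_fst_starJoin l' g K h₂ hg₁.natCarried
    have hsnd := map_snd_starJoin l' g K h₂ hg₁.natCarried
    have p1 : IsProbabilityMeasure (l'.map Prod.fst) :=
      Measure.isProbabilityMeasure_map measurable_fst.aemeasurable
    have p2 : IsProbabilityMeasure (l'.map Prod.snd) :=
      Measure.isProbabilityMeasure_map measurable_snd.aemeasurable
    have p3 : IsProbabilityMeasure (g.map Prod.fst) :=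
      Measure.isProbabilityMeasure_map measurable_fst.aemeasurable
    have p4 : IsProbabilityMeasure (g.map Prod.snd) :=
      Measure.isProbabilityMeasure_map measurable_snd.aemeasurable
    rw [hstep, hfst, hsnd]
    refine ⟨isProbabilityMeasure_starJoin l' g K h₂ hg₁.natCarried,
      h₁.map_pairBase hg₁.natCarried K, h₂.map_pairBase hg₂.natCarried K, ?_, ?_, ?_⟩
    · rw [massMoment_map_pairBase t h₁ hg₁, ← add_assoc, pow_succ]
      gcongr
    · rw [massMoment_map_pairBase (-t) h₂ hg₂, ← add_assoc, pow_succ]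
      gcongr
    rw [ENNReal.mul_rpow_pow] at hm₁ hm₂
    have hε : ∀ h : ℝ → ℝ, l' {z | z.1 = h z.2} ≤ 3 * r ^ (m + n) :=
      measure_fst_eq_le l' h₂
        (measure_lt_mass_le _ ht (pow_ne_zero _ hc₁) (ENNReal.pow_ne_top hc₁') hm₁)
        (measure_mass_lt_le _ ht (pow_ne_zero _ hc₂) (ENNReal.pow_ne_top hc₂') hm₂)
        (by rw [← mul_pow]; gcongr)
    obtain ⟨Ψ'', hΨ''⟩ := exists_predictor_starJoin l' g h₁ h₂ hg₁ hg₂ hΨ' hε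
    refine ⟨Ψ'', hΨ''.trans_eq ?_⟩
    rw [Finset.sum_range_succ, add_assoc]

lemma encodeBlock_eq {N κ : ℕ} (z : Fin κ → Fin N) :
    encodeBlock z = ((finFunctionFinEquiv fun i => z (Fin.rev i) : Fin (N ^ κ)) : ℕ) := by
  rw [finFunctionFinEquiv_apply, encodeBlock, ← Equiv.sum_comp Fin.revPerm]
  push_cast
  refine Finset.sum_congr rfl fun i _ => ?_
  rw [Fin.revPerm_apply, Fin.val_rev]
  congr 2
  omega

lemma encodeBlock_injective {N κ : ℕ} :
    Function.Injective (encodeBlock : (Fin κ → Fin N) → ℝ) := by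
  intro x y h
  rw [encodeBlock_eq, encodeBlock_eq, Nat.cast_inj, Fin.val_inj,
    EmbeddingLike.apply_eq_iff_eq] at h
  funext i
  simpa using congrFun h (Fin.rev i)

lemma encodeInit_eq {N κ m : ℕ} (f : Fin m → Fin κ → Fin N) :
    encodeInit f = encodeBlock fun i => finFunctionFinEquiv fun j => f i (Fin.rev j) := by
  simp only [encodeInit, encodeBlock_eq (f _)]
  simp [encodeBlock]

lemma encodeInit_injective {N κ m : ℕ} :
    Function.Injective (encodeInit : (Fin m → Fin κ → Fin N) → ℝ) := by
  intro x y h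
  rw [encodeInit_eq, encodeInit_eq] at h
  funext i j
  have h' := congrFun (encodeBlock_injective h) i
  rw [EmbeddingLike.apply_eq_iff_eq] at h'
  simpa using congrFun h' (Fin.rev j)

lemma map_map_encode_fst {X Y : Type*} [MeasurableSpace X] [MeasurableSpace Y] (γ : Measure (X × Y))
    {f : X → ℝ} {g : Y → ℝ} (hf : Measurable f) (hg : Measurable g) :
    (γ.map fun z => (f z.1, g z.2)).map Prod.fst = (γ.map Prod.fst).map f := by
  rw [Measure.map_map measurable_fst (by fun_prop), Measure.map_map hf measurable_fst]
  rfl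

lemma map_map_encode_snd {X Y : Type*} [MeasurableSpace X] [MeasurableSpace Y] (γ : Measure (X × Y))
    {f : X → ℝ} {g : Y → ℝ} (hf : Measurable f) (hg : Measurable g) :
    (γ.map fun z => (f z.1, g z.2)).map Prod.snd = (γ.map Prod.snd).map g := by
  rw [Measure.map_map measurable_snd (by fun_prop), Measure.map_map hg measurable_snd]
  rfl

lemma prodCoupling_map_fst {α β : Type*} [MeasurableSpace α] [MeasurableSpace β] (m : ℕ)
    (Γ : Measure (α × β)) [IsProbabilityMeasure Γ] :
    (prodCoupling m Γ).map Prod.fst = Measure.pi fun _ : Fin m => Γ.map Prod.fst := by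
  have : IsProbabilityMeasure (Γ.map Prod.fst) :=
    Measure.isProbabilityMeasure_map measurable_fst.aemeasurable
  rw [prodCoupling, Measure.map_map measurable_fst (by fun_prop),
    ← Measure.pi_map_pi fun _ => measurable_fst.aemeasurable]
  rfl

lemma prodCoupling_map_snd {α β : Type*} [MeasurableSpace α] [MeasurableSpace β] (m : ℕ)
    (Γ : Measure (α × β)) [IsProbabilityMeasure Γ] :
    (prodCoupling m Γ).map Prod.snd = Measure.pi fun _ : Fin m => Γ.map Prod.snd := by
  have : IsProbabilityMeasure (Γ.map Prod.snd) :=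
    Measure.isProbabilityMeasure_map measurable_snd.aemeasurable
  rw [prodCoupling, Measure.map_map measurable_snd (by fun_prop),
    ← Measure.pi_map_pi fun _ => measurable_snd.aemeasurable]
  rfl

lemma ENNReal.exists_mul_pow_lt {C r ε : ℝ≥0∞} (hC : C ≠ ⊤) (hr : r < 1) (hε : ε ≠ 0) :
    ∃ m : ℕ, 0 < m ∧ C * r ^ m < ε := by
  have h : Filter.Tendsto (fun m : ℕ => C * r ^ m) Filter.atTop (nhds (C * 0)) :=
    ENNReal.Tendsto.const_mul (ENNReal.tendsto_pow_atTop_nhds_zero_of_lt_one hr) (Or.inr hC)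
  rw [mul_zero] at h
  obtain ⟨m, h1, h2⟩ := ((h.eventually_lt_const (pos_iff_ne_zero.2 hε)).and
    (Filter.eventually_gt_atTop 0)).exists
  exact ⟨m, h2, h1⟩

lemma natCarriedBelow_map_encodeBlock {N κ : ℕ} (μ : Measure (Fin κ → Fin N)) :
    NatCarriedBelow (μ.map encodeBlock) (N ^ κ) := by
  have hr : ∀ᵐ x ∂(μ.map encodeBlock), x ∈ Set.range (encodeBlock : (Fin κ → Fin N) → ℝ) :=
    ae_map_mem_range _ (Set.finite_range _).measurableSet _
  filter_upwards [hr]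
  rintro _ ⟨z, rfl⟩
  exact ⟨_, Fin.is_lt _, encodeBlock_eq z⟩

lemma natCarried_map_encodeInit {N κ m : ℕ} (μ : Measure (Fin m → Fin κ → Fin N)) :
    NatCarried (μ.map encodeInit) := by
  have hr : ∀ᵐ x ∂(μ.map encodeInit), x ∈ Set.range (encodeInit : (Fin m → Fin κ → Fin N) → ℝ) :=
    ae_map_mem_range _ (Set.finite_range _).measurableSet _
  filter_upwards [hr]
  rintro _ ⟨z, rfl⟩
  rw [encodeInit_eq]
  exact ⟨_, encodeBlock_eq _⟩

lemma sum_mul_pow_add_le (K r : ℝ≥0∞) (m n : ℕ) :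
    4 * r ^ m + ∑ i ∈ Finset.range n, K * (3 * r ^ (m + i)) ≤
      (4 + K * 3 * (1 - r)⁻¹) * r ^ m := by
  calc 4 * r ^ m + ∑ i ∈ Finset.range n, K * (3 * r ^ (m + i))
      = 4 * r ^ m + K * 3 * (∑ i ∈ Finset.range n, r ^ i) * r ^ m := by
        congr 1
        rw [Finset.mul_sum, Finset.sum_mul]
        refine Finset.sum_congr rfl fun i _ => ?_
        rw [pow_add]
        ring
    _ ≤ 4 * r ^ m + K * 3 * (∑' i, r ^ i) * r ^ m := by
        gcongr
        exact ENNReal.sum_le_tsum _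
    _ = (4 + K * 3 * (1 - r)⁻¹) * r ^ m := by
        rw [ENNReal.tsum_geometric]
        ring

lemma one_sub_lt_measure_of_compl_lt {Ω : Type*} [MeasurableSpace Ω] (μ : Measure Ω)
    [IsProbabilityMeasure μ] {s : Set Ω} {ε : ℝ≥0∞} (hs : μ sᶜ < min 1 ε) :
    1 - ε < μ s := by
  have h1 : 1 ≤ μ s + μ sᶜ := by
    rw [← measure_univ (μ := μ), ← Set.union_compl_self s]
    exact measure_union_le _ _
  have hs1 := hs.trans_le (min_le_left _ _)
  have hs2 := hs.trans_le (min_le_right _ _)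
  by_contra! h
  rcases le_total 1 ε with hε1 | hε1
  · rw [tsub_eq_zero_of_le hε1] at h
    rw [le_antisymm h zero_le, zero_add] at h1
    exact absurd hs1 (not_lt.2 h1)
  · refine absurd h1 (not_le.2 ?_)
    calc μ s + μ sᶜ < (1 - ε) + ε :=
          ENNReal.add_lt_add_of_le_of_lt (measure_ne_top _ _) h hs2
      _ = 1 := tsub_add_cancel_of_le hε1

/-- del Junco-type proposition: given an ergodic monotone joining `ζ` of `p^ℤ` and `q^ℤ` with
`H(p) > H(q)`, and `κ` such that the conditioned restriction `Γ = ζ|_{[1,κ]}( · | x ≠ a^κ)`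
has an entropy gap between its marginals, for every `η > 0` there are `m` and a measure `β̄`
subordinate to `Γ^m` with the same marginals, such that for every `n ≥ 1` the iterative
star-coupling `W_n` of `β̄, Γ, …, Γ` is, up to probability `η`, supported on the graph of a
deterministic function `Ψ`. -/
theorem delJunco_star_almost_deterministic {N : ℕ} (p q : Fin N → ℝ)
    (hp0 : ∀ i, 0 ≤ p i) (hp1 : ∑ i, p i = 1)
    (hq0 : ∀ i, 0 ≤ q i) (hq1 : ∑ i, q i = 1)
    (hH : shannonH p > shannonH q)
    (hdom : ∀ k : Fin N, ∑ i ∈ Finset.Iic k, p i ≤ ∑ i ∈ Finset.Iic k, q i)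
    (μ ν : Measure (ℤ → Fin N)) (hμ : IsBernoulli p μ) (hν : IsBernoulli q ν)
    -- ζ is an ergodic monotone joining of p^ℤ and q^ℤ
    (ζ : Measure ((ℤ → Fin N) × (ℤ → Fin N))) (hζ : IsProbabilityMeasure ζ)
    (hζ1 : ζ.map Prod.fst = μ) (hζ2 : ζ.map Prod.snd = ν)
    (hζerg : Ergodic (fun z => (shiftMap z.1, shiftMap z.2)) ζ)
    (hζmono : ζ {z | z.2 0 ≤ z.1 0} = 1)
    (a : Fin N) (hpa0 : 0 < p a) (hpa1 : p a < 1)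
    (κ : ℕ) (hκ : 0 < κ)
    -- Γ is the restriction of ζ to the coordinates 1, …, κ, conditioned on {x ≠ a^κ}
    (Γ : Measure ((Fin κ → Fin N) × (Fin κ → Fin N))) [IsProbabilityMeasure Γ]
    (hΓ : Γ = (ζ.map fun z =>
        ((fun i : Fin κ => z.1 (((i : ℕ) : ℤ) + 1)),
         (fun i : Fin κ => z.2 (((i : ℕ) : ℤ) + 1))))[|{z | z.1 ≠ fun _ => a}])
    -- the entropy of the first marginal of Γ strictly exceeds that of the second marginal
    (hent : entropyOf (Γ.map Prod.fst) > entropyOf (Γ.map Prod.snd)) :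
    ∀ η : ℝ, 0 < η →
      ∃ m : ℕ, 0 < m ∧
        ∃ β : Measure ((Fin m → Fin κ → Fin N) × (Fin m → Fin κ → Fin N)),
          IsProbabilityMeasure β ∧
          -- β is subordinate to Γ^m
          (∀ z : (Fin m → Fin κ → Fin N) × (Fin m → Fin κ → Fin N),
            prodCoupling m Γ {z} = 0 → β {z} = 0) ∧
          -- β has the same marginals as Γ^m
          β.map Prod.fst = (prodCoupling m Γ).map Prod.fst ∧
          β.map Prod.snd = (prodCoupling m Γ).map Prod.snd ∧
          -- for every n ≥ 1, the iterative star-coupling W_n of β, Γ, …, Γ is within η of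
          -- being supported on the graph of a deterministic function Ψ
          ∀ n : ℕ, 1 ≤ n →
            ∃ Ψ : ℝ → ℝ,
              1 - ENNReal.ofReal η <
                iterStar (β.map fun z => (encodeInit z.1, encodeInit z.2))
                  (Γ.map fun z => (encodeBlock z.1, encodeBlock z.2))
                  ((N : ℝ) ^ κ) n {w : ℝ × ℝ | w.2 = Ψ w.1} := by
  intro η hη
  have hΓ₁ : IsProbabilityMeasure (Γ.map Prod.fst) :=
    Measure.isProbabilityMeasure_map measurable_fst.aemeasurable
  have hΓ₂ : IsProbabilityMeasure (Γ.map Prod.snd) :=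
    Measure.isProbabilityMeasure_map measurable_snd.aemeasurable
  obtain ⟨t, c₁, c₂, r, ht, hc₁, hc₁', hc₂, hc₂', hr, hm₁, hm₂, hc⟩ :=
    exists_massMoment_gap (Γ.map Prod.fst) (Γ.map Prod.snd) hent
  have hC : 4 + ((N ^ κ : ℕ) : ℝ≥0∞) * 3 * (1 - r)⁻¹ ≠ ⊤ := by
    have : (1 - r)⁻¹ ≠ ⊤ := ENNReal.inv_ne_top.2 (tsub_pos_of_lt hr).ne'
    finiteness
  obtain ⟨m, hm, hmη⟩ := ENNReal.exists_mul_pow_lt hC hr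
    (ε := min 1 (ENNReal.ofReal η)) (by simp [hη])
  have hprod : IsProbabilityMeasure (prodCoupling m Γ) :=
    Measure.isProbabilityMeasure_map (by fun_prop)
  have hM₁ : massMoment t ((prodCoupling m Γ).map Prod.fst) ≤ (r * c₁ ^ t) ^ m := by
    rw [prodCoupling_map_fst, massMoment_pi]
    gcongr
  have hM₂ : massMoment (-t) ((prodCoupling m Γ).map Prod.snd) ≤ (r * c₂ ^ (-t)) ^ m := by
    rw [prodCoupling_map_snd, massMoment_pi]
    gcongr
  have hP₁ : IsProbabilityMeasure ((prodCoupling m Γ).map Prod.fst) :=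
    Measure.isProbabilityMeasure_map measurable_fst.aemeasurable
  have hP₂ : IsProbabilityMeasure ((prodCoupling m Γ).map Prod.snd) :=
    Measure.isProbabilityMeasure_map measurable_snd.aemeasurable
  obtain ⟨β, hβ, hsub, hβ₁, hβ₂, Ψ, hΨ⟩ := exists_almost_graph_coupling (prodCoupling m Γ)
    (measure_lt_mass_le _ ht (pow_ne_zero m hc₁) (ENNReal.pow_ne_top hc₁')
      (by rwa [← ENNReal.mul_rpow_pow]))
    (measure_mass_lt_le _ ht (pow_ne_zero m hc₂) (ENNReal.pow_ne_top hc₂')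
      (by rwa [← ENNReal.mul_rpow_pow]))
    (by rw [← mul_pow]; gcongr)
  refine ⟨m, hm, β, hβ, hsub, hβ₁, hβ₂, fun n _ => ?_⟩
  have hI : Measurable (encodeInit : (Fin m → Fin κ → Fin N) → ℝ) := .of_discrete
  have hB : Measurable (encodeBlock : (Fin κ → Fin N) → ℝ) := .of_discrete
  have hl : IsProbabilityMeasure (β.map fun z => (encodeInit z.1, encodeInit z.2)) :=
    Measure.isProbabilityMeasure_map (by fun_prop)
  have hg : IsProbabilityMeasure (Γ.map fun z => (encodeBlock z.1, encodeBlock z.2)) :=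
    Measure.isProbabilityMeasure_map (by fun_prop)
  have hmap : ∀ {X : Type} [MeasurableSpace X] (s : ℝ) (μ : Measure X) [IsFiniteMeasure μ]
      {f : X → ℝ}, Measurable f → Function.Injective f →
      massMoment s (μ.map f) = massMoment s μ := fun s μ _ f hf hinj =>
    massMoment_map_of_injOn s μ hf (.of_forall Set.mem_univ) hinj.injOn
  obtain ⟨hprob, -, -, -, -, Ψ', hΨ'⟩ := exists_predictor_iterStar
    (β.map fun z => (encodeInit z.1, encodeInit z.2))
    (Γ.map fun z => (encodeBlock z.1, encodeBlock z.2)) (K := N ^ κ) (m := m) (δ := 4 * r ^ m)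
    (by rw [map_map_encode_fst _ hI hI]; exact natCarried_map_encodeInit _)
    (by rw [map_map_encode_snd _ hI hI]; exact natCarried_map_encodeInit _)
    (by rw [map_map_encode_fst _ hB hB]; exact natCarriedBelow_map_encodeBlock _)
    (by rw [map_map_encode_snd _ hB hB]; exact natCarriedBelow_map_encodeBlock _)
    ht hc₁ hc₁' hc₂ hc₂' hc
    (by rwa [map_map_encode_fst _ hB hB, hmap _ _ hB encodeBlock_injective])
    (by rwa [map_map_encode_snd _ hB hB, hmap _ _ hB encodeBlock_injective])
    (by rwa [map_map_encode_fst _ hI hI, hβ₁, hmap _ _ hI encodeInit_injective])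
    (by rwa [map_map_encode_snd _ hI hI, hβ₂, hmap _ _ hI encodeInit_injective])
    (Ψ := Function.extend encodeInit (fun x => encodeInit (Ψ x)) 0)
    (by
      refine le_trans ?_ hΨ
      have hnull : NullMeasurableSet {z : ℝ × ℝ | z.2 ≠ Function.extend encodeInit
          (fun x => encodeInit (Ψ x)) 0 z.1}
          (β.map fun z => (encodeInit z.1, encodeInit z.2)) :=
        nullMeasurableSet_of_ae_nat
          (by rw [map_map_encode_fst _ hI hI]; exact natCarried_map_encodeInit _)
          (by rw [map_map_encode_snd _ hI hI]; exact natCarried_map_encodeInit _) _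
      rw [Measure.map_apply₀ (by fun_prop) hnull]
      refine measure_mono fun z hz hzΨ => hz ?_
      simp only [encodeInit_injective.extend_apply, hzΨ])
    n
  refine ⟨Ψ', ?_⟩
  push_cast at hprob hΨ'
  refine one_sub_lt_measure_of_compl_lt _ ?_
  refine lt_of_le_of_lt (hΨ'.trans ?_) hmη
  have := sum_mul_pow_add_le ((N ^ κ : ℕ) : ℝ≥0∞) r m n
  push_cast at this ⊢
  exact this
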